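/- arXiv:2009.05155 — 2 statements merged into one kernel-verified Lean document; each statement's English description precedes it below -/
import Mathlib

section
/- Fix p ∈ (0,1). There exist constants C̃, c̃ ∈ (0,∞) such that for every n ≥ 2, under the Erdős–Rényi measure G(n,p), the probability that | Σ_{i=1}^n (K_i − Θ)² − σ² n² | ≥ 2σ² n² is at most C̃ · exp(−c̃ √n), where Θ = (n−1)p and σ² = p(1−p). -/
open scoped Classical
open Finset

/-- The real adjacency matrix of a simple graph on `Fin n`. -/
noncomputable def adjMat {n : ℕ} (g : SimpleGraph (Fin n)) : Matrix (Fin n) (Fin n) ℝ :=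
  g.adjMatrix ℝ

/-- The number of edges of a simple graph on `Fin n`. -/
noncomputable def edgeCount {n : ℕ} (g : SimpleGraph (Fin n)) : ℕ := g.edgeFinset.card

/-- The Erdős–Rényi `G(n,p)` probability of a single graph `g`:
`p ^ m (1-p) ^ (C(n,2) - m)` where `m` is the number of edges of `g`. -/
noncomputable def erWeight (n : ℕ) (p : ℝ) (g : SimpleGraph (Fin n)) : ℝ :=
  p ^ edgeCount g * (1 - p) ^ (n.choose 2 - edgeCount g)

/-- The Erdős–Rényi `G(n,p)` probability of a set `S` of graphs on `Fin n`. -/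
noncomputable def erProb (n : ℕ) (p : ℝ) (S : Set (SimpleGraph (Fin n))) : ℝ :=
  ∑ g : SimpleGraph (Fin n), if g ∈ S then erWeight n p g else 0

/-- The degree `K_i(g) = Σ_j A_{ij}(g)` of vertex `i`, as a real number. -/
noncomputable def degR {n : ℕ} (g : SimpleGraph (Fin n)) (i : Fin n) : ℝ :=
  ∑ j, adjMat g i j

/-- The sum of the centred indicators `1[e ∈ T] - p` over the elements `e` of `S` with `τ e = i`. -/
noncomputable def centredFiberSum {α ι : Type*} [DecidableEq α] [DecidableEq ι]
    (p : ℝ) (τ : α → ι) (S T : Finset α) (i : ι) : ℝ :=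
  ∑ e ∈ S with τ e = i, ((if e ∈ T then (1 : ℝ) else 0) - p)

section CentredFiberSum

variable {α ι : Type*} [DecidableEq α] [DecidableEq ι]

lemma abs_centredFiberSum_le {p : ℝ} (hp0 : 0 ≤ p) (hp1 : p ≤ 1) (τ : α → ι)
    (S T : Finset α) (i : ι) :
    |centredFiberSum p τ S T i| ≤ ({e ∈ S | τ e = i} : Finset α).card := by
  unfold centredFiberSum
  refine (Finset.abs_sum_le_sum_abs _ _).trans ?_
  refine (Finset.sum_le_card_nsmul _ _ 1 fun e _ => ?_).trans (by simp)
  split_ifs <;> rw [abs_le] <;> constructor <;> linarith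

lemma centredFiberSum_insert (p : ℝ) (τ : α → ι) {S : Finset α} (T : Finset α) {e : α}
    (he : e ∉ S) (i : ι) :
    centredFiberSum p τ (insert e S) T i = centredFiberSum p τ S T i +
      if τ e = i then (if e ∈ T then (1 : ℝ) else 0) - p else 0 := by
  unfold centredFiberSum
  rw [Finset.sum_filter, Finset.sum_insert he, Finset.sum_filter, add_comm]

lemma centredFiberSum_insert_right (p : ℝ) (τ : α → ι) {S : Finset α} (T : Finset α) {e : α}
    (he : e ∉ S) (i : ι) :
    centredFiberSum p τ S (insert e T) i = centredFiberSum p τ S T i := by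
  unfold centredFiberSum
  refine Finset.sum_congr rfl fun x hx => ?_
  have : x ≠ e := fun h => he (h ▸ (Finset.mem_filter.1 hx).1)
  simp [this]

/-- Adding one centred Bernoulli variable to `a` inside `exp (l * a ^ 2)`. -/
lemma bernoulli_exp_sq_le {p a l L D : ℝ} (hp0 : 0 ≤ p) (hp1 : p ≤ 1) (hl : 0 ≤ l) (hlL : l ≤ L)
    (ha : |a| ≤ D) (hD : L * (2 * D + 1) ≤ 1) :
    (1 - p) * Real.exp (l * (a - p) ^ 2) + p * Real.exp (l * (a + (1 - p)) ^ 2) ≤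
      Real.exp (L * (p * (1 - p)) * (1 + 2 * L) + (l + 8 * l ^ 2) * a ^ 2) := by
  have hq : 0 ≤ 1 - p := by linarith
  have hL : 0 ≤ L := hl.trans hlL
  have hD0 : 0 ≤ D := (abs_nonneg a).trans ha
  have key : ∀ x : ℝ, |x| ≤ 1 → Real.exp (l * (a + x) ^ 2) ≤
      Real.exp (l * a ^ 2) *
        (1 + 2 * l * a * x + (l + 8 * l ^ 2 * a ^ 2 + 2 * l ^ 2) * x ^ 2) := by
    intro x hx
    have hx2 : x ^ 2 ≤ 1 := (sq_le_one_iff_abs_le_one x).2 hx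
    have hax : |a * x| ≤ D := by
      rw [abs_mul]
      calc |a| * |x| ≤ D * 1 := mul_le_mul ha hx (abs_nonneg _) hD0
        _ = D := mul_one D
    have ht : |2 * l * a * x + l * x ^ 2| ≤ 1 := by
      have h1 : 2 * l * a * x + l * x ^ 2 = l * (2 * (a * x) + x ^ 2) := by ring
      rw [h1, abs_mul, abs_of_nonneg hl]
      have h2 : |2 * (a * x) + x ^ 2| ≤ 2 * D + 1 := by
        have := abs_le.1 hax
        rw [abs_le]; constructor <;> nlinarith [sq_nonneg x]
      exact (mul_le_mul hlL h2 (abs_nonneg _) hL).trans hD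
    have h3 := (abs_le.1 (Real.abs_exp_sub_one_sub_id_le ht)).2
    have h4 : l * (a + x) ^ 2 = l * a ^ 2 + (2 * l * a * x + l * x ^ 2) := by ring
    rw [h4, Real.exp_add]
    refine mul_le_mul_of_nonneg_left ?_ (Real.exp_nonneg _)
    have h5 : (2 * l * a * x + l * x ^ 2) ^ 2 ≤ 8 * l ^ 2 * a ^ 2 * x ^ 2 + 2 * l ^ 2 * x ^ 2 := by
      nlinarith [sq_nonneg (2 * l * a * x - l * x ^ 2),
        mul_nonneg (mul_nonneg (sq_nonneg l) (sq_nonneg x)) (sub_nonneg.2 hx2)]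
    linarith
  have k0 := key (-p) (by rw [abs_le]; constructor <;> linarith)
  have k1 := key (1 - p) (by rw [abs_le]; constructor <;> linarith)
  rw [← sub_eq_add_neg] at k0
  have hs : 0 ≤ p * (1 - p) := mul_nonneg hp0 hq
  have hs1 : p * (1 - p) ≤ 1 := by nlinarith
  have hsum := add_le_add (mul_le_mul_of_nonneg_left k0 hq) (mul_le_mul_of_nonneg_left k1 hp0)
  refine hsum.trans ?_
  have e1 : L * (p * (1 - p)) * (1 + 2 * L) + (l + 8 * l ^ 2) * a ^ 2 =
      l * a ^ 2 + (L * (p * (1 - p)) * (1 + 2 * L) + 8 * l ^ 2 * a ^ 2) := by ring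
  rw [e1, Real.exp_add]
  have e2 := Real.add_one_le_exp (L * (p * (1 - p)) * (1 + 2 * L) + 8 * l ^ 2 * a ^ 2)
  have e3 : l * (p * (1 - p)) * (1 + 2 * l) ≤ L * (p * (1 - p)) * (1 + 2 * L) := by gcongr
  have e4 : 8 * l ^ 2 * a ^ 2 * (p * (1 - p)) ≤ 8 * l ^ 2 * a ^ 2 :=
    mul_le_of_le_one_right (by positivity) hs1
  calc _ = Real.exp (l * a ^ 2) *
        (1 + l * (p * (1 - p)) * (1 + 2 * l) + 8 * l ^ 2 * a ^ 2 * (p * (1 - p))) := by ring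
    _ ≤ _ := mul_le_mul_of_nonneg_left (by linarith) (Real.exp_nonneg _)

/-- Exponential moment of a weighted sum of squares of the centred fibre sums of a random subset
of `S` which contains each element independently with probability `p`. -/
theorem sum_powerset_exp_centredFiberSum_sq_le [Fintype ι] {p L D : ℝ} (hp0 : 0 ≤ p) (hp1 : p ≤ 1)
    (hD : L * (2 * D + 1) ≤ 1) (τ : α → ι) (S : Finset α) :
    ∀ l : ι → ℝ, (∀ i, 0 ≤ l i) →
      (∀ i, (({e ∈ S | τ e = i} : Finset α).card : ℝ) ≤ D) →
      (∀ i, l i + 8 * ({e ∈ S | τ e = i} : Finset α).card * L ^ 2 ≤ L) →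
      ∑ T ∈ S.powerset, p ^ T.card * (1 - p) ^ (S.card - T.card) *
          Real.exp (∑ i, l i * centredFiberSum p τ S T i ^ 2) ≤
        Real.exp (S.card * (L * (p * (1 - p)) * (1 + 2 * L))) := by
  induction S using Finset.induction_on with
  | empty => intro l _ _ _; simp [centredFiberSum]
  | insert e S he ih =>
    intro l hl hcard hL
    have hq : 0 ≤ 1 - p := by linarith
    set k := τ e with hk
    set M := L * (p * (1 - p)) * (1 + 2 * L) with hM
    have hfk : (({x ∈ insert e S | τ x = k} : Finset α).card : ℝ) =
        ({x ∈ S | τ x = k} : Finset α).card + 1 := by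
      rw [Finset.filter_insert, if_pos hk.symm, Finset.card_insert_of_notMem (by simp [he])]
      push_cast; rfl
    have hfi : ∀ i, i ≠ k → ({x ∈ insert e S | τ x = i} : Finset α) = {x ∈ S | τ x = i} := by
      intro i hi
      rw [Finset.filter_insert, if_neg (fun h => hi (h.symm.trans hk.symm))]
    set l' := Function.update l k (l k + 8 * l k ^ 2) with hl'
    have hlk : l k ≤ L := by
      have : (0 : ℝ) ≤ 8 * ({x ∈ insert e S | τ x = k} : Finset α).card * L ^ 2 := by positivity
      linarith [hL k]
    have hcard' : ∀ i, (({x ∈ S | τ x = i} : Finset α).card : ℝ) ≤ D := fun i =>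
      le_trans (by gcongr; exact Finset.subset_insert e S) (hcard i)
    have ih' := ih l' (fun i => by
        by_cases h : i = k
        · simp only [h, hl', Function.update_self]; have := hl k; positivity
        · simp only [hl', Function.update_of_ne h]; exact hl i) hcard' (fun i => by
        by_cases h : i = k
        · simp only [h, hl', Function.update_self]
          have h1 := hL k
          rw [hfk] at h1
          have h2 : l k ^ 2 ≤ L ^ 2 := pow_le_pow_left₀ (hl k) hlk 2
          linarith
        · simp only [hl', Function.update_of_ne h]
          rw [← hfi i h]; exact hL i)
    have hsplit : ∀ (m f : ι → ℝ), ∑ i, m i * f i ^ 2 =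
        m k * f k ^ 2 + ∑ i ∈ Finset.univ.erase k, m i * f i ^ 2 := fun m f =>
      (Finset.add_sum_erase _ _ (Finset.mem_univ k)).symm
    rw [Finset.sum_powerset_insert he, ← Finset.sum_add_distrib]
    calc _ ≤ ∑ T ∈ S.powerset, Real.exp M * (p ^ T.card * (1 - p) ^ (S.card - T.card) *
          Real.exp (∑ i, l' i * centredFiberSum p τ S T i ^ 2)) := by
          refine Finset.sum_le_sum fun T hT => ?_
          rw [Finset.mem_powerset] at hT
          have heT : e ∉ T := fun h => he (hT h)
          have hTS := Finset.card_le_card hT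
          rw [Finset.card_insert_of_notMem he, Finset.card_insert_of_notMem heT,
            Nat.add_sub_add_right, Nat.sub_add_comm hTS, hsplit, hsplit, hsplit l']
          have c1 : centredFiberSum p τ (insert e S) T k = centredFiberSum p τ S T k - p := by
            rw [centredFiberSum_insert p τ T he, if_pos hk.symm, if_neg heT]; ring
          have c2 : centredFiberSum p τ (insert e S) (insert e T) k =
              centredFiberSum p τ S T k + (1 - p) := by
            rw [centredFiberSum_insert p τ _ he, if_pos hk.symm, if_pos (by simp),
              centredFiberSum_insert_right p τ T he]
          have c3 : ∀ i ∈ Finset.univ.erase k, l i * centredFiberSum p τ (insert e S) T i ^ 2 =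
              l i * centredFiberSum p τ S T i ^ 2 := fun i hi => by
            have hne : ¬ τ e = i := fun h => (Finset.mem_erase.1 hi).1 (h.symm.trans hk.symm)
            rw [centredFiberSum_insert p τ T he, if_neg hne, add_zero]
          have c4 : ∀ i ∈ Finset.univ.erase k,
              l i * centredFiberSum p τ (insert e S) (insert e T) i ^ 2 =
              l i * centredFiberSum p τ S T i ^ 2 := fun i hi => by
            have hne : ¬ τ e = i := fun h => (Finset.mem_erase.1 hi).1 (h.symm.trans hk.symm)
            rw [centredFiberSum_insert p τ _ he, if_neg hne, add_zero,
              centredFiberSum_insert_right p τ T he]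
          have c5 : ∀ i ∈ Finset.univ.erase k, l' i * centredFiberSum p τ S T i ^ 2 =
              l i * centredFiberSum p τ S T i ^ 2 := fun i hi => by
            simp only [hl', Function.update_of_ne (Finset.mem_erase.1 hi).1]
          rw [Finset.sum_congr rfl c3, Finset.sum_congr rfl c4, Finset.sum_congr rfl c5, c1, c2,
            Real.exp_add, Real.exp_add, Real.exp_add]
          have hb := bernoulli_exp_sq_le hp0 hp1 (hl k) hlk
            ((abs_centredFiberSum_le hp0 hp1 τ S T k).trans (hcard' k)) hD
          rw [← hM, Real.exp_add] at hb
          have hlk' : l' k = l k + 8 * l k ^ 2 := by simp [hl']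
          rw [hlk']
          set R := Real.exp (∑ i ∈ Finset.univ.erase k, l i * centredFiberSum p τ S T i ^ 2)
          have hw : 0 ≤ p ^ T.card * (1 - p) ^ (S.card - T.card) * R :=
            mul_nonneg (mul_nonneg (pow_nonneg hp0 _) (pow_nonneg hq _)) (Real.exp_nonneg _)
          have := mul_le_mul_of_nonneg_left hb hw
          calc _ = _ := by ring
            _ ≤ _ := this
            _ = _ := by ring
      _ ≤ Real.exp M * Real.exp (S.card * M) := by
          rw [← Finset.mul_sum]
          exact mul_le_mul_of_nonneg_left ih' (Real.exp_nonneg _)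
      _ = _ := by
          rw [← Real.exp_add, Finset.card_insert_of_notMem he]
          congr 1; push_cast; ring

end CentredFiberSum

section ErdosRenyi

variable {n : ℕ}

lemma erWeight_nonneg {p : ℝ} (hp0 : 0 ≤ p) (hp1 : p ≤ 1) (g : SimpleGraph (Fin n)) :
    0 ≤ erWeight n p g :=
  mul_nonneg (pow_nonneg hp0 _) (pow_nonneg (by linarith) _)

lemma card_edgeFinset_top_fin :
    (⊤ : SimpleGraph (Fin n)).edgeFinset.card = n.choose 2 := by
  rw [SimpleGraph.card_edgeFinset_top_eq_card_choose_two, Fintype.card_fin]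

/-- A `G(n,p)` expectation is bounded by the corresponding sum over sets of edges. -/
lemma sum_erWeight_mul_le {p : ℝ} (hp0 : 0 ≤ p) (hp1 : p ≤ 1) (F : Finset (Sym2 (Fin n)) → ℝ)
    (hF : ∀ T, 0 ≤ F T) :
    ∑ g : SimpleGraph (Fin n), erWeight n p g * F g.edgeFinset ≤
      ∑ T ∈ (⊤ : SimpleGraph (Fin n)).edgeFinset.powerset, p ^ T.card *
        (1 - p) ^ ((⊤ : SimpleGraph (Fin n)).edgeFinset.card - T.card) * F T := by
  have hinj : Set.InjOn (fun g : SimpleGraph (Fin n) => g.edgeFinset)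
      (Finset.univ : Finset (SimpleGraph (Fin n))) := fun g _ h _ hgh =>
    SimpleGraph.edgeFinset_inj.1 hgh
  calc _ = ∑ T ∈ Finset.univ.image fun g : SimpleGraph (Fin n) => g.edgeFinset, p ^ T.card *
        (1 - p) ^ ((⊤ : SimpleGraph (Fin n)).edgeFinset.card - T.card) * F T := by
        rw [Finset.sum_image hinj]
        refine Finset.sum_congr rfl fun g _ => ?_
        rw [card_edgeFinset_top_fin, erWeight, edgeCount]
    _ ≤ _ := by
        refine Finset.sum_le_sum_of_subset_of_nonneg ?_ fun T _ _ =>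
          mul_nonneg (mul_nonneg (pow_nonneg hp0 _) (pow_nonneg (by linarith) _)) (hF T)
        intro T hT
        obtain ⟨g, _, rfl⟩ := Finset.mem_image.1 hT
        exact Finset.mem_powerset.2 (SimpleGraph.edgeFinset_mono le_top)

lemma sum_edge_sup_eq (f : Sym2 (Fin n) → ℝ) (i : Fin n) :
    ∑ e ∈ (⊤ : SimpleGraph (Fin n)).edgeFinset with e.sup = i, f e = ∑ j with j < i, f s(i, j) := by
  symm
  refine Finset.sum_bij (fun j _ => s(i, j)) ?_ ?_ ?_ fun _ _ => rfl
  · intro j hj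
    have hj : j < i := by simpa using hj
    simp [hj.le, hj.ne']
  · exact fun a _ b _ h => Sym2.congr_right.1 h
  · intro e
    induction e using Sym2.ind with | _ a b
    intro h
    simp only [Finset.mem_filter, SimpleGraph.mem_edgeFinset, SimpleGraph.mem_edgeSet,
      SimpleGraph.top_adj, Sym2.sup_mk] at h
    obtain ⟨hab, rfl⟩ := h
    rcases lt_or_gt_of_ne hab with h | h
    · exact ⟨a, by simp [h], by simp [h.le, Sym2.eq_swap]⟩
    · exact ⟨b, by simp [h], by simp [h.le]⟩

lemma sum_edge_inf_eq (f : Sym2 (Fin n) → ℝ) (i : Fin n) :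
    ∑ e ∈ (⊤ : SimpleGraph (Fin n)).edgeFinset with e.inf = i, f e = ∑ j with i < j, f s(i, j) := by
  symm
  refine Finset.sum_bij (fun j _ => s(i, j)) ?_ ?_ ?_ fun _ _ => rfl
  · intro j hj
    have hj : i < j := by simpa using hj
    simp [hj.le, hj.ne]
  · exact fun a _ b _ h => Sym2.congr_right.1 h
  · intro e
    induction e using Sym2.ind with | _ a b
    intro h
    simp only [Finset.mem_filter, SimpleGraph.mem_edgeFinset, SimpleGraph.mem_edgeSet,
      SimpleGraph.top_adj, Sym2.inf_mk] at h
    obtain ⟨hab, rfl⟩ := h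
    rcases lt_or_gt_of_ne hab with h | h
    · exact ⟨b, by simp [h], by simp [h.le]⟩
    · exact ⟨a, by simp [h], by simp [h.le, Sym2.eq_swap]⟩

lemma card_edge_sup_le (i : Fin n) :
    (({e ∈ (⊤ : SimpleGraph (Fin n)).edgeFinset | e.sup = i} : Finset _).card : ℝ) ≤ n := by
  have h := sum_edge_sup_eq (fun _ => 1) i
  simp only [Finset.sum_const, nsmul_eq_mul, mul_one] at h
  rw [h]
  exact_mod_cast (Finset.card_le_univ _).trans (Fintype.card_fin n).le

lemma card_edge_inf_le (i : Fin n) :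
    (({e ∈ (⊤ : SimpleGraph (Fin n)).edgeFinset | e.inf = i} : Finset _).card : ℝ) ≤ n := by
  have h := sum_edge_inf_eq (fun _ => 1) i
  simp only [Finset.sum_const, nsmul_eq_mul, mul_one] at h
  rw [h]
  exact_mod_cast (Finset.card_le_univ _).trans (Fintype.card_fin n).le

/-- The centred degree splits into the contributions of smaller and of larger neighbours. -/
lemma degR_sub_eq (p : ℝ) (g : SimpleGraph (Fin n)) (i : Fin n) :
    degR g i - (n - 1 : ℝ) * p =
      centredFiberSum p Sym2.sup (⊤ : SimpleGraph (Fin n)).edgeFinset g.edgeFinset i +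
      centredFiberSum p Sym2.inf (⊤ : SimpleGraph (Fin n)).edgeFinset g.edgeFinset i := by
  unfold centredFiberSum
  rw [sum_edge_sup_eq, sum_edge_inf_eq]
  have hdisj : Disjoint (Finset.univ.filter fun j : Fin n => j < i)
      (Finset.univ.filter fun j : Fin n => i < j) :=
    Finset.disjoint_filter.2 fun _ _ h => h.not_gt
  rw [← Finset.sum_union hdisj]
  have hunion : (Finset.univ.filter fun j : Fin n => j < i) ∪
      (Finset.univ.filter fun j : Fin n => i < j) = Finset.univ.erase i := by
    ext j; simp [lt_or_lt_iff_ne]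
  rw [hunion, Finset.sum_sub_distrib]
  have hn : 1 ≤ n := i.pos
  congr 1
  · unfold degR adjMat
    rw [← Finset.add_sum_erase _ _ (Finset.mem_univ i)]
    simp [SimpleGraph.adjMatrix_apply]
  · simp [Finset.card_erase_of_mem, Nat.cast_sub hn]

/-- Exponential moment under `G(n,p)` of the sum of squared centred fibre sums. -/
lemma sum_erWeight_exp_le {p : ℝ} (hp0 : 0 ≤ p) (hp1 : p ≤ 1) (hn : 0 < n)
    (τ : Sym2 (Fin n) → Fin n)
    (hτ : ∀ i, (({e ∈ (⊤ : SimpleGraph (Fin n)).edgeFinset | τ e = i} : Finset _).card : ℝ) ≤ n) :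
    ∑ g : SimpleGraph (Fin n), erWeight n p g * Real.exp (∑ i, (3 / (196 * n) : ℝ) *
        centredFiberSum p τ (⊤ : SimpleGraph (Fin n)).edgeFinset g.edgeFinset i ^ 2) ≤
      Real.exp (p * (1 - p) * n * (29 / 3136)) := by
  have hn' : (1 : ℝ) ≤ n := by exact_mod_cast hn
  have hs : 0 ≤ p * (1 - p) := mul_nonneg hp0 (by linarith)
  refine (sum_erWeight_mul_le hp0 hp1 (fun T => Real.exp (∑ i, (3 / (196 * n) : ℝ) *
        centredFiberSum p τ (⊤ : SimpleGraph (Fin n)).edgeFinset T i ^ 2))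
        fun T => Real.exp_nonneg _).trans ?_
  refine (sum_powerset_exp_centredFiberSum_sq_le (L := 1 / (56 * n)) (D := n) hp0 hp1 ?_ τ _
    (fun _ => 3 / (196 * n)) (fun i => by positivity) hτ fun i => ?_).trans ?_
  · rw [div_mul_eq_mul_div, div_le_one (by positivity)]; linarith
  · have : 8 * (({e ∈ (⊤ : SimpleGraph (Fin n)).edgeFinset | τ e = i} : Finset _).card : ℝ) *
        (1 / (56 * n)) ^ 2 ≤ 8 * n * (1 / (56 * n)) ^ 2 := by
      gcongr; exact_mod_cast hτ i
    refine (add_le_add_right this _).trans (le_of_eq ?_)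
    field_simp; norm_num
  · rw [card_edgeFinset_top_fin, Nat.cast_choose_two]
    refine Real.exp_le_exp.2 ?_
    have h1 : (1 : ℝ) / (56 * n) ≤ 1 / 56 := by
      apply one_div_le_one_div_of_le <;> linarith
    calc (n * (n - 1) / 2 : ℝ) * (1 / (56 * n) * (p * (1 - p)) * (1 + 2 * (1 / (56 * n))))
        ≤ (n * n / 2 : ℝ) * (1 / (56 * n) * (p * (1 - p)) * (1 + 2 * (1 / 56))) := by
          gcongr; linarith
      _ = _ := by field_simp; ring

end ErdosRenyi

/-- Concentration of `Σ_i (K_i - Θ)²` around `σ² n²` under `G(n,p)`: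
there are constants `C̃, c̃ ∈ (0,∞)` such that, for all `n ≥ 2`,
`P( |Σ_i (K_i - Θ)² - σ² n²| ≥ 2 σ² n² ) ≤ C̃ exp(-c̃ √n)`,
where `Θ = (n-1)p` and `σ² = p(1-p)`. -/
theorem degree_square_sum_concentration_sqrt
    (p : ℝ) (hp : p ∈ Set.Ioo (0 : ℝ) 1) :
    ∃ Ctil ctil : ℝ, 0 < Ctil ∧ 0 < ctil ∧
      ∀ n : ℕ, 2 ≤ n →
        erProb n p
            {g : SimpleGraph (Fin n) |
              2 * (p * (1 - p)) * (n : ℝ) ^ 2 ≤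
                |(∑ i, (degR g i - (n - 1 : ℝ) * p) ^ 2)
                  - p * (1 - p) * (n : ℝ) ^ 2|}
          ≤ Ctil * Real.exp (-ctil * Real.sqrt n) := by
  obtain ⟨hp0, hp1⟩ := hp
  have hs : 0 < p * (1 - p) := mul_pos hp0 (by linarith)
  refine ⟨2, p * (1 - p) * (7 / 3136), two_pos, by positivity, fun n hn => ?_⟩
  have hn0 : 0 < n := by omega
  have hn1 : (1 : ℝ) ≤ n := by exact_mod_cast hn0
  set E := (⊤ : SimpleGraph (Fin n)).edgeFinset
  let V : (Sym2 (Fin n) → Fin n) → SimpleGraph (Fin n) → ℝ := fun τ g =>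
    Real.exp (∑ i, (3 / (196 * n) : ℝ) * centredFiberSum p τ E g.edgeFinset i ^ 2)
  set K := Real.exp (-(p * (1 - p) * n * (36 / 3136))) with hK
  have hV : ∀ τ g, p * (1 - p) * n ^ 2 * (3 / 4) ≤
      ∑ i, centredFiberSum p τ E g.edgeFinset i ^ 2 → 1 ≤ K * V τ g := by
    intro τ g h
    simp only [hK, V]
    rw [← Real.exp_add, ← Finset.mul_sum]
    refine Real.one_le_exp ?_
    have := mul_le_mul_of_nonneg_left h (by positivity : (0 : ℝ) ≤ 3 / (196 * n))
    have e : (3 / (196 * n) : ℝ) * (p * (1 - p) * n ^ 2 * (3 / 4)) =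
        p * (1 - p) * n * (36 / 3136) := by field_simp; norm_num
    linarith
  have hV0 : ∀ τ g, 0 ≤ K * V τ g := fun τ g => by positivity
  have hmarkov : ∀ g : SimpleGraph (Fin n), 2 * (p * (1 - p)) * (n : ℝ) ^ 2 ≤
      |(∑ i, (degR g i - (n - 1 : ℝ) * p) ^ 2) - p * (1 - p) * (n : ℝ) ^ 2| →
      1 ≤ K * V Sym2.sup g + K * V Sym2.inf g := by
    intro g hg
    have hX : 0 ≤ ∑ i, (degR g i - (n - 1 : ℝ) * p) ^ 2 :=
      Finset.sum_nonneg fun _ _ => sq_nonneg _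
    have hle : ∑ i, (degR g i - (n - 1 : ℝ) * p) ^ 2 ≤
        2 * ∑ i, centredFiberSum p Sym2.sup E g.edgeFinset i ^ 2 +
        2 * ∑ i, centredFiberSum p Sym2.inf E g.edgeFinset i ^ 2 := by
      rw [Finset.mul_sum, Finset.mul_sum, ← Finset.sum_add_distrib]
      refine Finset.sum_le_sum fun i _ => ?_
      rw [degR_sub_eq]
      linarith [add_sq_le (a := centredFiberSum p Sym2.sup E g.edgeFinset i)
        (b := centredFiberSum p Sym2.inf E g.edgeFinset i)]
    have hpos : 0 < p * (1 - p) * (n : ℝ) ^ 2 := by positivity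
    have hbig : 3 * (p * (1 - p) * (n : ℝ) ^ 2) ≤ ∑ i, (degR g i - (n - 1 : ℝ) * p) ^ 2 := by
      rcases le_abs.1 hg with h | h <;> linarith
    by_cases h : p * (1 - p) * n ^ 2 * (3 / 4) ≤
        ∑ i, centredFiberSum p Sym2.sup E g.edgeFinset i ^ 2
    · linarith [hV _ g h, hV0 Sym2.inf g]
    · push Not at h
      linarith [hV Sym2.inf g (by linarith), hV0 Sym2.sup g]
  have hsum : ∀ τ : Sym2 (Fin n) → Fin n,
      (∀ i, (({e ∈ E | τ e = i} : Finset _).card : ℝ) ≤ n) →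
      ∑ g, erWeight n p g * (K * V τ g) ≤ Real.exp (-(p * (1 - p) * (7 / 3136)) * √n) := by
    intro τ hτ
    have h1 := sum_erWeight_exp_le hp0.le hp1.le hn0 τ hτ
    have h2 : √(n : ℝ) ≤ n := Real.sqrt_le_iff.2 ⟨by linarith, by nlinarith⟩
    calc _ = K * ∑ g, erWeight n p g * V τ g := by
          rw [Finset.mul_sum]; exact Finset.sum_congr rfl fun g _ => by ring
      _ ≤ K * Real.exp (p * (1 - p) * n * (29 / 3136)) :=
          mul_le_mul_of_nonneg_left h1 (Real.exp_nonneg _)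
      _ ≤ _ := by
          rw [hK, ← Real.exp_add]
          refine Real.exp_le_exp.2 ?_
          nlinarith [mul_le_mul_of_nonneg_left h2 hs.le]
  calc erProb n p _
      ≤ ∑ g, (erWeight n p g * (K * V Sym2.sup g) + erWeight n p g * (K * V Sym2.inf g)) := by
        refine Finset.sum_le_sum fun g _ => ?_
        have hw := erWeight_nonneg hp0.le hp1.le g
        rw [← mul_add]
        split_ifs with hg
        · exact le_mul_of_one_le_right hw (hmarkov g hg)
        · exact mul_nonneg hw (add_nonneg (hV0 _ _) (hV0 _ _))
    _ ≤ _ := by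
        rw [Finset.sum_add_distrib]
        linarith [hsum _ card_edge_sup_le, hsum _ card_edge_inf_le]
end

section
/- Fix p ∈ (0,1). For every η > 0 there exist constants ζ, Λ ∈ (0,∞) such that for all n ≥ 2, under the Erdős–Rényi measure G(n,p), the probability that | (Σ_{i=1}^n K_i²)/(Σ_{i=1}^n K_i) − λ1 | ≥ η/√n is at most Λ · exp(−ζ √n), where λ1 = λ1(g) is the largest eigenvalue of the adjacency matrix of the random graph g (with the convention that division by zero yields zero). -/
open scoped Classical
open Finset

/-- The largest eigenvalue of a real matrix, as the supremum of its spectrum. -/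
noncomputable def lam1 {n : ℕ} (M : Matrix (Fin n) (Fin n) ℝ) : ℝ := sSup (spectrum ℝ M)

/-! ### Finite product Bernoulli expectations -/

/-- The weight of a Bernoulli outcome. -/
noncomputable def bernWeight (p : ℝ) (b : Bool) : ℝ := if b then p else 1 - p

/-- Expectation over independent Bernoulli variables indexed by a finite type. -/
noncomputable def bernExp {ι : Type*} [Fintype ι] [DecidableEq ι] (p : ℝ) (f : (ι → Bool) → ℝ) : ℝ :=
  ∑ ω : ι → Bool, (∏ e, bernWeight p (ω e)) * f ω

/-- Probability of an event under independent Bernoulli variables. -/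
noncomputable def bernProb {ι : Type*} [Fintype ι] [DecidableEq ι] (p : ℝ) (P : (ι → Bool) → Prop) : ℝ :=
  bernExp p fun ω => if P ω then 1 else 0

/-- The centred value of a Bernoulli outcome. -/
noncomputable def centred (p : ℝ) (b : Bool) : ℝ := (if b then 1 else 0) - p

section Bernoulli

variable {ι : Type*} [Fintype ι] [DecidableEq ι] {p : ℝ}

lemma bernWeight_nonneg (hp : p ∈ Set.Icc (0 : ℝ) 1) (b : Bool) : 0 ≤ bernWeight p b := by
  obtain ⟨h0, h1⟩ := hp
  cases b <;> simp [bernWeight] <;> linarith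

lemma bernExp_prod (φ : ι → Bool → ℝ) :
    bernExp p (fun ω => ∏ e, φ e (ω e)) = ∏ e, (p * φ e true + (1 - p) * φ e false) := by
  have h := Finset.prod_univ_sum (fun _ : ι => (Finset.univ : Finset Bool))
    (fun e b => bernWeight p b * φ e b)
  rw [Fintype.piFinset_univ] at h
  simp only [bernExp, ← Finset.prod_mul_distrib]
  rw [← h]
  exact Finset.prod_congr rfl fun e _ => by simp [bernWeight]

lemma bernExp_one : bernExp p (fun _ : ι → Bool => (1 : ℝ)) = 1 := by
  have h := bernExp_prod (p := p) (fun (_ : ι) (_ : Bool) => (1 : ℝ))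
  simpa using h

lemma bernExp_mono (hp : p ∈ Set.Icc (0 : ℝ) 1) {f g : (ι → Bool) → ℝ} (h : ∀ ω, f ω ≤ g ω) :
    bernExp p f ≤ bernExp p g :=
  Finset.sum_le_sum fun ω _ => mul_le_mul_of_nonneg_left (h ω)
    (Finset.prod_nonneg fun _ _ => bernWeight_nonneg hp _)

lemma bernExp_add (f g : (ι → Bool) → ℝ) :
    bernExp p (fun ω => f ω + g ω) = bernExp p f + bernExp p g := by
  simp [bernExp, mul_add, Finset.sum_add_distrib]

lemma bernExp_const_mul (c : ℝ) (f : (ι → Bool) → ℝ) :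
    bernExp p (fun ω => c * f ω) = c * bernExp p f := by
  simp only [bernExp, Finset.mul_sum]
  exact Finset.sum_congr rfl fun _ _ => by ring

lemma bernExp_sum {κ : Type*} (s : Finset κ) (f : κ → (ι → Bool) → ℝ) :
    bernExp p (fun ω => ∑ k ∈ s, f k ω) = ∑ k ∈ s, bernExp p (f k) := by
  simp only [bernExp, Finset.mul_sum]
  exact Finset.sum_comm

lemma bernExp_const (c : ℝ) : bernExp p (fun _ : ι → Bool => c) = c := by
  have h := bernExp_const_mul (ι := ι) (p := p) c (fun _ => 1)
  rw [bernExp_one] at h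
  simpa using h

lemma bernExp_comm {κ : Type*} [Fintype κ] [DecidableEq κ] {p' : ℝ} (f : (ι → Bool) → (κ → Bool) → ℝ) :
    bernExp p (fun ω => bernExp p' (f ω)) = bernExp p' (fun δ => bernExp p fun ω => f ω δ) := by
  simp only [bernExp, Finset.mul_sum]
  rw [Finset.sum_comm]
  exact Finset.sum_congr rfl fun _ _ => Finset.sum_congr rfl fun _ _ => by ring

lemma bernExp_resample (e : ι) (f : (ι → Bool) → ℝ) :
    bernExp p f = bernExp p fun ω =>
      p * f (Function.update ω e true) + (1 - p) * f (Function.update ω e false) := by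
  set g : (ι → Bool) → ℝ := fun ω =>
      p * f (Function.update ω e true) + (1 - p) * f (Function.update ω e false) with hg
  set τ : (ι → Bool) → (ι → Bool) := fun ω => Function.update ω e (!ω e) with hτ
  have hinv : Function.Involutive τ := by
    intro ω; simp [hτ]
  have hsum : ∀ F : (ι → Bool) → ℝ, ∑ ω, F (τ ω) = ∑ ω, F ω := fun F =>
    Equiv.sum_comp (hinv.toPerm τ) F
  have hw : ∀ ω : ι → Bool, ∏ j, bernWeight p (ω j) =
      bernWeight p (ω e) * ∏ j ∈ Finset.univ.erase e, bernWeight p (ω j) := fun ω =>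
    (Finset.mul_prod_erase _ _ (Finset.mem_univ e)).symm
  have hw' : ∀ ω : ι → Bool, ∏ j, bernWeight p (τ ω j) =
      bernWeight p (!ω e) * ∏ j ∈ Finset.univ.erase e, bernWeight p (ω j) := by
    intro ω
    rw [hw]
    congr 1
    · simp [hτ]
    · exact Finset.prod_congr rfl fun j hj => by
        simp [hτ, Function.update_of_ne (Finset.ne_of_mem_erase hj)]
  have key : ∀ ω : ι → Bool,
      (∏ j, bernWeight p (ω j)) * f ω + (∏ j, bernWeight p (τ ω j)) * f (τ ω) =
      (∏ j, bernWeight p (ω j)) * g ω + (∏ j, bernWeight p (τ ω j)) * g (τ ω) := by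
    intro ω
    rw [hw, hw']
    have hgτ : g (τ ω) = g ω := by simp [hg, hτ]
    rw [hgτ]
    have hupd : f ω = f (Function.update ω e (ω e)) := by simp
    rw [hupd]
    simp only [hg, hτ]
    cases ω e <;> simp [bernWeight] <;> ring
  have h2 : bernExp p f + bernExp p f = bernExp p g + bernExp p g := by
    have a : ∀ F : (ι → Bool) → ℝ, bernExp p F + bernExp p F =
        ∑ ω, ((∏ j, bernWeight p (ω j)) * F ω + (∏ j, bernWeight p (τ ω j)) * F (τ ω)) := by
      intro F
      rw [Finset.sum_add_distrib, hsum (fun ω => (∏ j, bernWeight p (ω j)) * F ω)]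
      rfl
    rw [a, a]
    exact Finset.sum_congr rfl fun ω _ => key ω
  linarith

lemma bernExp_mul_of_indep (e : ι) (φ : Bool → ℝ) (g : (ι → Bool) → ℝ)
    (hg : ∀ ω b, g (Function.update ω e b) = g ω) :
    bernExp p (fun ω => φ (ω e) * g ω) = (p * φ true + (1 - p) * φ false) * bernExp p g := by
  rw [bernExp_resample e, ← bernExp_const_mul]
  congr 1
  funext ω
  simp only [hg, Function.update_self]
  ring

lemma bernProb_mono (hp : p ∈ Set.Icc (0 : ℝ) 1) {P Q : (ι → Bool) → Prop}
    (h : ∀ ω, P ω → Q ω) : bernProb p P ≤ bernProb p Q := by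
  refine bernExp_mono hp fun ω => ?_
  by_cases hP : P ω
  · simp [hP, h ω hP]
  · simp only [hP, if_false]; split_ifs <;> norm_num

lemma bernProb_nonneg (hp : p ∈ Set.Icc (0 : ℝ) 1) (P : (ι → Bool) → Prop) :
    0 ≤ bernProb p P := by
  rw [← bernExp_const (ι := ι) (p := p) 0]
  exact bernExp_mono hp fun ω => by split_ifs <;> norm_num

lemma bernProb_le_one (hp : p ∈ Set.Icc (0 : ℝ) 1) (P : (ι → Bool) → Prop) :
    bernProb p P ≤ 1 := by
  rw [← bernExp_const (ι := ι) (p := p) 1]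
  exact bernExp_mono hp fun ω => by split_ifs <;> norm_num

lemma bernProb_or_le (hp : p ∈ Set.Icc (0 : ℝ) 1) (P Q : (ι → Bool) → Prop) :
    bernProb p (fun ω => P ω ∨ Q ω) ≤ bernProb p P + bernProb p Q := by
  rw [bernProb, bernProb, bernProb, ← bernExp_add]
  refine bernExp_mono hp fun ω => ?_
  by_cases hP : P ω <;> by_cases hQ : Q ω <;> simp [hP, hQ]

lemma bernProb_exists_le (hp : p ∈ Set.Icc (0 : ℝ) 1) {κ : Type*} [Fintype κ]
    (P : κ → (ι → Bool) → Prop) :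
    bernProb p (fun ω => ∃ k, P k ω) ≤ ∑ k, bernProb p (P k) := by
  simp only [bernProb]
  rw [← bernExp_sum]
  refine bernExp_mono hp fun ω => ?_
  split_ifs with h
  · obtain ⟨k, hk⟩ := h
    refine le_trans ?_ (Finset.single_le_sum (f := fun k => if P k ω then (1 : ℝ) else 0)
      (fun i _ => by positivity) (Finset.mem_univ k))
    simp [hk]
  · exact Finset.sum_nonneg fun i _ => by positivity

lemma bernProb_eq_zero {P : (ι → Bool) → Prop} (h : ∀ ω, ¬ P ω) : bernProb p P = 0 := by
  simp [bernProb, h, bernExp]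

/-- If every slice of a bounded two-parameter function is small with high probability, then so is
its average over the second parameter. -/
lemma bernProb_average_le (hp : p ∈ Set.Icc (0 : ℝ) 1) {κ : Type*} [Fintype κ] [DecidableEq κ] {p' : ℝ}
    (hp' : p' ∈ Set.Icc (0 : ℝ) 1) (f : (ι → Bool) → (κ → Bool) → ℝ) {t M q : ℝ} (ht : 0 < t)
    (hM : 0 ≤ M) (hf : ∀ ω δ, |f ω δ| ≤ M)
    (hq : ∀ δ, bernProb p (fun ω => t ≤ |f ω δ|) ≤ q) :
    bernProb p (fun ω => 2 * t ≤ |bernExp p' (f ω)|) ≤ M / t * q := by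
  have h1 : ∀ ω, |bernExp p' (f ω)| ≤ t + M * bernProb p' (fun δ => t ≤ |f ω δ|) := by
    intro ω
    have hpt : ∀ δ, |f ω δ| ≤ t + M * (if t ≤ |f ω δ| then 1 else 0) := by
      intro δ
      split_ifs with h
      · linarith [hf ω δ]
      · push Not at h; linarith
    have hu : bernExp p' (fun δ => t + M * (if t ≤ |f ω δ| then 1 else 0)) =
        t + M * bernProb p' (fun δ => t ≤ |f ω δ|) := by
      rw [bernExp_add, bernExp_const, bernExp_const_mul]; rfl
    rw [abs_le, ← hu]
    constructor
    · have := bernExp_mono hp' (fun δ => (abs_le.1 (hpt δ)).1)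
      have hneg := bernExp_const_mul (p := p') (-1)
        (fun δ => t + M * (if t ≤ |f ω δ| then 1 else 0))
      simp only [neg_one_mul] at hneg
      linarith
    · exact bernExp_mono hp' fun δ => (le_abs_self _).trans (hpt δ)
  calc bernProb p (fun ω => 2 * t ≤ |bernExp p' (f ω)|)
      ≤ bernExp p (fun ω => M / t * bernProb p' (fun δ => t ≤ |f ω δ|)) := by
        refine bernExp_mono hp fun ω => ?_
        have hn := bernProb_nonneg hp' (fun δ => t ≤ |f ω δ|)
        split_ifs with h
        · rw [div_mul_eq_mul_div, le_div_iff₀ ht]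
          linarith [h1 ω]
        · positivity
    _ = M / t * bernExp p' (fun δ => bernProb p (fun ω => t ≤ |f ω δ|)) := by
        rw [bernExp_const_mul]
        simp only [bernProb]
        rw [bernExp_comm]
    _ ≤ M / t * q := by
        refine mul_le_mul_of_nonneg_left ?_ (by positivity)
        rw [← bernExp_const (ι := κ) (p := p') q]
        exact bernExp_mono hp' hq

lemma abs_centred_le (hp : p ∈ Set.Icc (0 : ℝ) 1) (b : Bool) : |centred p b| ≤ 1 := by
  obtain ⟨h0, h1⟩ := hp
  cases b <;> simp [centred, abs_le] <;> constructor <;> linarith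

lemma exp_le_add_exp_sq (x : ℝ) : Real.exp x ≤ x + Real.exp (x ^ 2) := by
  rcases le_or_gt |x| 1 with h | h
  · have h1 := (abs_le.1 (Real.abs_exp_sub_one_sub_id_le h)).2
    have h2 := Real.add_one_le_exp (x ^ 2)
    linarith
  · rcases lt_abs.1 h with h | h
    · have : Real.exp x ≤ Real.exp (x ^ 2) := Real.exp_le_exp.2 (by nlinarith)
      linarith
    · have h1 : Real.exp x ≤ 1 := Real.exp_le_one_iff.2 (by linarith)
      have h2 := Real.add_one_le_exp (x ^ 2)
      nlinarith

lemma centred_mgf_le (hp : p ∈ Set.Icc (0 : ℝ) 1) (s : ℝ) :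
    p * Real.exp (s * centred p true) + (1 - p) * Real.exp (s * centred p false) ≤
      Real.exp (s ^ 2) := by
  have key : ∀ b, Real.exp (s * centred p b) ≤ s * centred p b + Real.exp (s ^ 2) := by
    intro b
    refine (exp_le_add_exp_sq _).trans (add_le_add le_rfl (Real.exp_le_exp.2 ?_))
    have := abs_le.1 (abs_centred_le hp b)
    have h2 : centred p b ^ 2 ≤ 1 := by nlinarith
    nlinarith [sq_nonneg s]
  have h1 := mul_le_mul_of_nonneg_left (key true) hp.1
  have h2 := mul_le_mul_of_nonneg_left (key false) (sub_nonneg.2 hp.2)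
  have h3 : p * (s * centred p true) + (1 - p) * (s * centred p false) = 0 := by
    simp [centred]; ring
  nlinarith

/-- Exponential moments of a linear form whose coefficients do not depend on the variables they
multiply. -/
lemma bernExp_exp_linear_le (hp : p ∈ Set.Icc (0 : ℝ) 1) (s : ℝ) (T : Finset ι)
    (a : (ι → Bool) → ι → ℝ) (ha : ∀ e ∈ T, ∀ ω b, a (Function.update ω e b) = a ω)
    (c : (ι → Bool) → ℝ) (hc0 : ∀ ω, 0 ≤ c ω)
    (hc : ∀ e ∈ T, ∀ ω b, c (Function.update ω e b) = c ω) :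
    bernExp p (fun ω => c ω * Real.exp (s * ∑ e ∈ T, a ω e * centred p (ω e))) ≤
      bernExp p (fun ω => c ω * Real.exp (s ^ 2 * ∑ e ∈ T, a ω e ^ 2)) := by
  induction T using Finset.induction_on generalizing c with
  | empty => simp
  | insert e T he ih =>
    have hne : ∀ f ∈ T, f ≠ e := fun f hf h => he (h ▸ hf)
    have haT : ∀ f ∈ T, ∀ ω b, a (Function.update ω f b) = a ω :=
      fun f hf => ha f (Finset.mem_insert_of_mem hf)
    have hae := ha e (Finset.mem_insert_self e T)
    have hce := hc e (Finset.mem_insert_self e T)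
    have h1 := ih haT (fun ω => c ω * Real.exp (s * (a ω e * centred p (ω e))))
      (fun ω => mul_nonneg (hc0 ω) (Real.exp_pos _).le) (fun f hf ω b => by
        rw [hc f (Finset.mem_insert_of_mem hf), haT f hf,
          Function.update_of_ne (hne f hf).symm])
    have e1 : (fun ω => c ω * Real.exp (s * ∑ f ∈ insert e T, a ω f * centred p (ω f))) =
        fun ω => c ω * Real.exp (s * (a ω e * centred p (ω e))) *
          Real.exp (s * ∑ f ∈ T, a ω f * centred p (ω f)) := by
      funext ω
      rw [Finset.sum_insert he, mul_add, Real.exp_add, mul_assoc]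
    rw [e1]
    refine h1.trans ?_
    rw [bernExp_resample e]
    refine bernExp_mono hp fun ω => ?_
    simp only [hae, hce, Function.update_self]
    rw [Finset.sum_insert he, mul_add, Real.exp_add]
    have h3 := centred_mgf_le hp (s * a ω e)
    have h4 : 0 ≤ c ω * Real.exp (s ^ 2 * ∑ f ∈ T, a ω f ^ 2) :=
      mul_nonneg (hc0 ω) (Real.exp_pos _).le
    have h5 := mul_le_mul_of_nonneg_left h3 h4
    rw [mul_pow] at h5
    simp only [mul_assoc] at h5 ⊢
    linarith

lemma bernProb_linear_upper (hp : p ∈ Set.Icc (0 : ℝ) 1) (T : Finset ι)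
    (a : (ι → Bool) → ι → ℝ) (ha : ∀ e ∈ T, ∀ ω b, a (Function.update ω e b) = a ω)
    {V t : ℝ} (hV : 0 < V) (ht : 0 ≤ t) :
    bernProb p (fun ω => t ≤ ∑ e ∈ T, a ω e * centred p (ω e) ∧ ∑ e ∈ T, a ω e ^ 2 ≤ V) ≤
      Real.exp (-(t ^ 2 / (4 * V))) := by
  set s : ℝ := t / (2 * V) with hs
  have hs0 : 0 ≤ s := by positivity
  set c : (ι → Bool) → ℝ := fun ω => if ∑ e ∈ T, a ω e ^ 2 ≤ V then 1 else 0 with hc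
  have h := bernExp_exp_linear_le hp s T a ha c (fun ω => by simp only [hc]; positivity)
    (fun e he ω b => by simp only [hc, ha e he])
  have h2 : bernExp p (fun ω => c ω * Real.exp (s ^ 2 * ∑ e ∈ T, a ω e ^ 2)) ≤
      Real.exp (s ^ 2 * V) := by
    rw [← bernExp_const (ι := ι) (p := p) (Real.exp (s ^ 2 * V))]
    refine bernExp_mono hp fun ω => ?_
    simp only [hc]
    split_ifs with hv
    · rw [one_mul]
      exact Real.exp_le_exp.2 (mul_le_mul_of_nonneg_left hv (sq_nonneg s))
    · simp [(Real.exp_pos _).le]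
  have h3 : bernProb p
      (fun ω => t ≤ ∑ e ∈ T, a ω e * centred p (ω e) ∧ ∑ e ∈ T, a ω e ^ 2 ≤ V) ≤
      Real.exp (-(s * t)) *
        bernExp p (fun ω => c ω * Real.exp (s * ∑ e ∈ T, a ω e * centred p (ω e))) := by
    rw [← bernExp_const_mul]
    refine bernExp_mono hp fun ω => ?_
    split_ifs with hω
    · simp only [hc, hω.2, if_true, one_mul]
      rw [← Real.exp_add]
      refine Real.one_le_exp ?_
      nlinarith [mul_le_mul_of_nonneg_left hω.1 hs0]
    · have : 0 ≤ c ω := by simp only [hc]; positivity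
      positivity
  refine h3.trans ((mul_le_mul_of_nonneg_left (h.trans h2) (Real.exp_pos _).le).trans ?_)
  rw [← Real.exp_add]
  refine Real.exp_le_exp.2 (le_of_eq ?_)
  rw [hs]; field_simp; ring

/-- A conditional Hoeffding inequality. -/
lemma bernProb_linear_le (hp : p ∈ Set.Icc (0 : ℝ) 1) (T : Finset ι)
    (a : (ι → Bool) → ι → ℝ) (ha : ∀ e ∈ T, ∀ ω b, a (Function.update ω e b) = a ω)
    {V t : ℝ} (hV : 0 < V) (ht : 0 ≤ t) :
    bernProb p (fun ω => t ≤ |∑ e ∈ T, a ω e * centred p (ω e)|) ≤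
      2 * Real.exp (-(t ^ 2 / (4 * V))) + bernProb p (fun ω => V < ∑ e ∈ T, a ω e ^ 2) := by
  have h1 := bernProb_linear_upper hp T a ha hV ht
  have h2 := bernProb_linear_upper hp T (fun ω e => -a ω e)
    (fun e he ω b => by rw [ha e he]) hV ht
  have h3 := bernProb_mono hp (P := fun ω => t ≤ |∑ e ∈ T, a ω e * centred p (ω e)|)
    (Q := fun ω => ((t ≤ ∑ e ∈ T, a ω e * centred p (ω e) ∧ ∑ e ∈ T, a ω e ^ 2 ≤ V) ∨
      (t ≤ ∑ e ∈ T, -a ω e * centred p (ω e) ∧ ∑ e ∈ T, (-a ω e) ^ 2 ≤ V)) ∨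
      V < ∑ e ∈ T, a ω e ^ 2) (fun ω hω => by
        by_cases hv : V < ∑ e ∈ T, a ω e ^ 2
        · exact Or.inr hv
        · push Not at hv
          left
          rcases le_abs.1 hω with h | h
          · exact Or.inl ⟨h, hv⟩
          · exact Or.inr ⟨by simpa using h, by simpa using hv⟩)
  have h4 := bernProb_or_le hp
    (fun ω => (t ≤ ∑ e ∈ T, a ω e * centred p (ω e) ∧ ∑ e ∈ T, a ω e ^ 2 ≤ V) ∨
      (t ≤ ∑ e ∈ T, -a ω e * centred p (ω e) ∧ ∑ e ∈ T, (-a ω e) ^ 2 ≤ V))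
    (fun ω => V < ∑ e ∈ T, a ω e ^ 2)
  have h5 := bernProb_or_le hp
    (fun ω => t ≤ ∑ e ∈ T, a ω e * centred p (ω e) ∧ ∑ e ∈ T, a ω e ^ 2 ≤ V)
    (fun ω => t ≤ ∑ e ∈ T, -a ω e * centred p (ω e) ∧ ∑ e ∈ T, (-a ω e) ^ 2 ≤ V)
  linarith

end Bernoulli

/-! ### Bounds of the form `Λ * exp (-ζ * √n)` -/

/-- Sequences bounded by `Λ * exp (-ζ * √n)` for some positive `ζ` and `Λ`. -/
def StretchedExpBound (f : ℕ → ℝ) : Prop :=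
  ∃ ζ Λ : ℝ, 0 < ζ ∧ 0 < Λ ∧ ∀ n : ℕ, f n ≤ Λ * Real.exp (-ζ * Real.sqrt n)

namespace StretchedExpBound

lemma exp_neg {c : ℝ} (hc : 0 < c) (C : ℝ) :
    StretchedExpBound fun n => C * Real.exp (-c * Real.sqrt n) :=
  ⟨c, |C| + 1, hc, by positivity, fun n => mul_le_mul_of_nonneg_right
    (by linarith [le_abs_self C]) (Real.exp_pos _).le⟩

lemma add {f g : ℕ → ℝ} (hf : StretchedExpBound f) (hg : StretchedExpBound g) :
    StretchedExpBound fun n => f n + g n := by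
  obtain ⟨ζ, Λ, hζ, hΛ, h⟩ := hf
  obtain ⟨ζ', Λ', hζ', hΛ', h'⟩ := hg
  refine ⟨min ζ ζ', Λ + Λ', lt_min hζ hζ', by positivity, fun n => ?_⟩
  have hs := Real.sqrt_nonneg (n : ℝ)
  have e1 : Real.exp (-ζ * Real.sqrt n) ≤ Real.exp (-min ζ ζ' * Real.sqrt n) :=
    Real.exp_le_exp.2 (by nlinarith [min_le_left ζ ζ'])
  have e2 : Real.exp (-ζ' * Real.sqrt n) ≤ Real.exp (-min ζ ζ' * Real.sqrt n) :=
    Real.exp_le_exp.2 (by nlinarith [min_le_right ζ ζ'])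
  have := mul_le_mul_of_nonneg_left e1 hΛ.le
  have := mul_le_mul_of_nonneg_left e2 hΛ'.le
  linarith [h n, h' n]

lemma const_mul {f : ℕ → ℝ} (hf : StretchedExpBound f) {c : ℝ} (hc : 0 ≤ c) :
    StretchedExpBound fun n => c * f n := by
  obtain ⟨ζ, Λ, hζ, hΛ, h⟩ := hf
  refine ⟨ζ, (c + 1) * Λ, hζ, by positivity, fun n => ?_⟩
  have h1 := mul_le_mul_of_nonneg_left (h n) hc
  have h2 : 0 ≤ Λ * Real.exp (-ζ * Real.sqrt n) := by positivity
  linarith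

lemma natCast_mul {f : ℕ → ℝ} (hf : StretchedExpBound f) :
    StretchedExpBound fun n => n * f n := by
  obtain ⟨ζ, Λ, hζ, hΛ, h⟩ := hf
  refine ⟨ζ / 2, 8 / ζ ^ 2 * Λ, by positivity, by positivity, fun n => ?_⟩
  have hs := Real.sqrt_nonneg (n : ℝ)
  have hq := Real.quadratic_le_exp_of_nonneg (x := ζ / 2 * Real.sqrt n) (by positivity)
  have hn : Real.sqrt (n : ℝ) ^ 2 = n := Real.sq_sqrt (Nat.cast_nonneg n)
  have h0 : 0 ≤ ζ / 2 * Real.sqrt n := by positivity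
  have h1 : (n : ℝ) ≤ 8 / ζ ^ 2 * Real.exp (ζ / 2 * Real.sqrt n) := by
    rw [div_mul_eq_mul_div, le_div_iff₀ (by positivity)]
    have : (ζ / 2 * Real.sqrt n) ^ 2 = ζ ^ 2 * n / 4 := by rw [mul_pow, hn]; ring
    nlinarith
  have h2 : Real.exp (-(ζ / 2) * Real.sqrt n) =
      Real.exp (ζ / 2 * Real.sqrt n) * Real.exp (-ζ * Real.sqrt n) := by
    rw [← Real.exp_add]; congr 1; ring
  calc n * f n ≤ n * (Λ * Real.exp (-ζ * Real.sqrt n)) :=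
        mul_le_mul_of_nonneg_left (h n) (Nat.cast_nonneg n)
    _ ≤ (8 / ζ ^ 2 * Real.exp (ζ / 2 * Real.sqrt n)) * (Λ * Real.exp (-ζ * Real.sqrt n)) :=
        mul_le_mul_of_nonneg_right h1 (by positivity)
    _ = 8 / ζ ^ 2 * Λ * Real.exp (-(ζ / 2) * Real.sqrt n) := by rw [h2]; ring

end StretchedExpBound

/-! ### The noise matrix -/

/-- The centred adjacency matrix, as a function of the edge variables. -/
noncomputable def noise {n : ℕ} (p : ℝ) (ω : Sym2 (Fin n) → Bool) (i j : Fin n) : ℝ :=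
  if i = j then 0 else centred p (ω s(i, j))

/-- The row sums of the noise matrix masked by `m`. -/
noncomputable def maskedRowSum {n : ℕ} (p : ℝ) (m : Sym2 (Fin n) → ℝ) (ω : Sym2 (Fin n) → Bool)
    (i : Fin n) : ℝ :=
  ∑ j, m s(i, j) * noise p ω i j

/-- The real indicator of a Boolean. -/
noncomputable def bit (b : Bool) : ℝ := if b then 1 else 0

section Noise

variable {n : ℕ} {p : ℝ}

lemma noise_self (ω : Sym2 (Fin n) → Bool) (i : Fin n) : noise p ω i i = 0 := by simp [noise]

lemma noise_comm (ω : Sym2 (Fin n) → Bool) (i j : Fin n) : noise p ω i j = noise p ω j i := by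
  simp only [noise, Sym2.eq_swap (a := i), eq_comm (a := i)]

lemma noise_eq_mul (ω : Sym2 (Fin n) → Bool) (i j : Fin n) :
    noise p ω i j = (if i = j then 0 else 1) * centred p (ω s(i, j)) := by
  unfold noise; split_ifs <;> simp

lemma noise_update (ω : Sym2 (Fin n) → Bool) {e : Sym2 (Fin n)} (b : Bool) {i j : Fin n}
    (h : s(i, j) ≠ e) : noise p (Function.update ω e b) i j = noise p ω i j := by
  simp only [noise, Function.update_of_ne h]

lemma abs_noise_le (hp : p ∈ Set.Icc (0 : ℝ) 1) (ω : Sym2 (Fin n) → Bool) (i j : Fin n) :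
    |noise p ω i j| ≤ 1 := by
  unfold noise; split_ifs
  · simp
  · exact abs_centred_le hp _

lemma noise_sq_le (hp : p ∈ Set.Icc (0 : ℝ) 1) (ω : Sym2 (Fin n) → Bool) (i j : Fin n) :
    noise p ω i j ^ 2 ≤ 1 := (sq_le_one_iff_abs_le_one _).2 (abs_noise_le hp ω i j)

lemma noise_sq (ω : Sym2 (Fin n) → Bool) (i j : Fin n) :
    noise p ω i j ^ 2 = (if i = j then 0 else p * (1 - p)) + (1 - 2 * p) * noise p ω i j := by
  unfold noise centred; split_ifs <;> ring

lemma maskedRowSum_update (m : Sym2 (Fin n) → ℝ) (ω : Sym2 (Fin n) → Bool) {e : Sym2 (Fin n)}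
    (b : Bool) (he : m e = 0) :
    maskedRowSum p m (Function.update ω e b) = maskedRowSum p m ω := by
  funext i
  refine Finset.sum_congr rfl fun j _ => ?_
  by_cases h : s(i, j) = e
  · rw [h, he, zero_mul, zero_mul]
  · rw [noise_update ω b h]

lemma abs_maskedRowSum_le (hp : p ∈ Set.Icc (0 : ℝ) 1) {m : Sym2 (Fin n) → ℝ}
    (hm : ∀ e, |m e| ≤ 1) (ω : Sym2 (Fin n) → Bool) (i : Fin n) :
    |maskedRowSum p m ω i| ≤ n := by
  refine (Finset.abs_sum_le_sum_abs _ _).trans ?_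
  refine (Finset.sum_le_card_nsmul _ _ 1 fun j _ => ?_).trans (by simp)
  rw [abs_mul]
  exact mul_le_one₀ (hm _) (abs_nonneg _) (abs_noise_le hp ω i j)

/-- A conditional Hoeffding inequality for linear forms indexed by ordered pairs of vertices. -/
lemma bernProb_pair_linear_le (hp : p ∈ Set.Icc (0 : ℝ) 1) (T : Set (Sym2 (Fin n)))
    (c : (Sym2 (Fin n) → Bool) → Fin n → Fin n → ℝ)
    (hc : ∀ e ∈ T, ∀ ω b, c (Function.update ω e b) = c ω)
    (hT : ∀ ω i j, s(i, j) ∉ T → c ω i j = 0) {V t : ℝ} (hV : 0 < V) (ht : 0 ≤ t) :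
    bernProb p (fun ω => t ≤ (∑ i, ∑ j, c ω i j * noise p ω i j) ^ 2) ≤
      2 * Real.exp (-(t / (8 * V))) + bernProb p (fun ω => V < ∑ i, ∑ j, c ω i j ^ 2) := by
  set d : (Sym2 (Fin n) → Bool) → Fin n × Fin n → ℝ :=
    fun ω q => c ω q.1 q.2 * (if q.1 = q.2 then 0 else 1) with hd
  set fib : Sym2 (Fin n) → Finset (Fin n × Fin n) :=
    fun e => Finset.univ.filter fun q => s(q.1, q.2) = e with hfib
  set a : (Sym2 (Fin n) → Bool) → Sym2 (Fin n) → ℝ := fun ω e => ∑ q ∈ fib e, d ω q with ha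
  have hfibcard : ∀ e, ((fib e).card : ℝ) ≤ 2 := by
    intro e
    induction e with
    | h x y =>
      have hsub : fib s(x, y) ⊆ {(x, y), (y, x)} := by
        intro q hq
        have := (Finset.mem_filter.1 hq).2
        rcases q with ⟨q1, q2⟩
        simpa using this
      exact_mod_cast (Finset.card_le_card hsub).trans Finset.card_le_two
  have hlin : ∀ ω, ∑ i, ∑ j, c ω i j * noise p ω i j =
      ∑ e ∈ T.toFinset, a ω e * centred p (ω e) := by
    intro ω
    have h1 : ∑ i, ∑ j, c ω i j * noise p ω i j =
        ∑ q : Fin n × Fin n, d ω q * centred p (ω s(q.1, q.2)) := by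
      rw [Fintype.sum_prod_type]
      exact Finset.sum_congr rfl fun i _ => Finset.sum_congr rfl fun j _ => by
        rw [noise_eq_mul, hd]; ring
    rw [h1, ← Finset.sum_fiberwise_of_maps_to (t := Finset.univ)
      (g := fun q : Fin n × Fin n => s(q.1, q.2)) (fun _ _ => Finset.mem_univ _)]
    have h2 : ∀ e, ∑ q ∈ fib e, d ω q * centred p (ω s(q.1, q.2)) = a ω e * centred p (ω e) := by
      intro e
      rw [ha, Finset.sum_mul]
      exact Finset.sum_congr rfl fun q hq => by rw [(Finset.mem_filter.1 hq).2]
    rw [Finset.sum_congr rfl fun e _ => h2 e]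
    symm
    refine Finset.sum_subset (Finset.subset_univ _) fun e _ he => ?_
    have : a ω e = 0 := Finset.sum_eq_zero fun q hq => by
      have hq' := (Finset.mem_filter.1 hq).2
      simp only [hd]
      rw [hT ω q.1 q.2 (by rw [hq']; simpa using he), zero_mul]
    rw [this, zero_mul]
  have hsq : ∀ ω, ∑ e ∈ T.toFinset, a ω e ^ 2 ≤ 2 * ∑ i, ∑ j, c ω i j ^ 2 := by
    intro ω
    calc ∑ e ∈ T.toFinset, a ω e ^ 2 ≤ ∑ e, a ω e ^ 2 :=
          Finset.sum_le_univ_sum_of_nonneg fun e => sq_nonneg _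
      _ ≤ ∑ e, 2 * ∑ q ∈ fib e, c ω q.1 q.2 ^ 2 := by
          refine Finset.sum_le_sum fun e _ => ?_
          refine (sq_sum_le_card_mul_sum_sq (s := fib e) (f := d ω)).trans ?_
          refine mul_le_mul (hfibcard e) (Finset.sum_le_sum fun q _ => ?_)
            (Finset.sum_nonneg fun q _ => sq_nonneg _) (by norm_num)
          simp only [hd]
          split_ifs
          · simpa using sq_nonneg (c ω q.1 q.2)
          · simp
      _ = 2 * ∑ i, ∑ j, c ω i j ^ 2 := by
          rw [← Finset.mul_sum, Finset.sum_fiberwise_of_maps_to (fun _ _ => Finset.mem_univ _),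
            Fintype.sum_prod_type]
  have hind : ∀ e ∈ T.toFinset, ∀ ω b, a (Function.update ω e b) = a ω := by
    intro e he ω b
    simp only [ha, hd, hc e (by simpa using he)]
  have h := bernProb_linear_le hp T.toFinset a hind (V := 2 * V) (t := Real.sqrt t)
    (by positivity) (Real.sqrt_nonneg t)
  rw [Real.sq_sqrt ht] at h
  refine (bernProb_mono hp fun ω hω => ?_).trans (h.trans (add_le_add (le_of_eq ?_)
    (bernProb_mono hp fun ω hω => ?_)))
  · rw [← hlin, ← Real.sqrt_sq_eq_abs]
    exact Real.sqrt_le_sqrt hω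
  · congr 3; ring
  · linarith [hsq ω]

end Noise

section Tails

variable {n : ℕ} {p : ℝ}

lemma sum_ite_eq_row (i : Fin n) (f : Fin n → Fin n → ℝ) :
    ∑ k, ∑ j, (if k = i then f k j else 0) = ∑ j, f i j := by
  rw [Finset.sum_eq_single i]
  · simp
  · intro k _ hk; simp [hk]
  · simp

lemma sqrt_natCast_pos (hn : 1 ≤ n) : 1 ≤ Real.sqrt n := by
  rw [Real.one_le_sqrt]; exact_mod_cast hn

lemma natCast_eq_sqrt_sq (n : ℕ) : (n : ℝ) = Real.sqrt n ^ 2 :=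
  (Real.sq_sqrt (Nat.cast_nonneg n)).symm

lemma bernProb_row_ge (hp : p ∈ Set.Icc (0 : ℝ) 1) (hn : 1 ≤ n) {m : Sym2 (Fin n) → ℝ}
    (hm : ∀ e, |m e| ≤ 1) (i : Fin n) :
    bernProb p (fun ω => Real.sqrt n ^ 3 ≤ maskedRowSum p m ω i ^ 2) ≤
      2 * Real.exp (-(1 / 8) * Real.sqrt n) := by
  have hs := sqrt_natCast_pos hn
  have hns := natCast_eq_sqrt_sq n
  have h := bernProb_pair_linear_le (n := n) hp Set.univ
    (fun _ k j => if k = i then m s(k, j) else 0) (fun _ _ _ _ => rfl)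
    (fun _ _ _ h => absurd (Set.mem_univ _) h) (V := n) (t := Real.sqrt n ^ 3)
    (by positivity) (by positivity)
  have hz : bernProb p (fun _ : Sym2 (Fin n) → Bool =>
      (n : ℝ) < ∑ k, ∑ j : Fin n, (if k = i then m s(k, j) else 0) ^ 2) = 0 := by
    refine bernProb_eq_zero fun _ => not_lt.2 ?_
    simp only [ite_pow, zero_pow two_ne_zero]
    rw [sum_ite_eq_row i (fun k j => m s(k, j) ^ 2)]
    refine (Finset.sum_le_card_nsmul _ _ 1 fun j _ => ?_).trans (by simp)
    exact (sq_le_one_iff_abs_le_one _).2 (hm _)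
  rw [hz, add_zero] at h
  simp only [ite_mul, zero_mul, sum_ite_eq_row i (fun k j => m s(k, j) * noise p _ k j)] at h
  refine h.trans (le_of_eq ?_)
  congr 2
  rw [hns]; simp only [Real.sqrt_sq (Real.sqrt_nonneg _)]
  field_simp

lemma bernProb_total_ge (hp : p ∈ Set.Icc (0 : ℝ) 1) (hn : 1 ≤ n) {ε : ℝ} (hε : 0 < ε) :
    bernProb p (fun ω : Sym2 (Fin n) → Bool =>
        ε * Real.sqrt n ^ 5 ≤ (∑ i, ∑ j, noise p ω i j) ^ 2) ≤
      2 * Real.exp (-(ε / 8) * Real.sqrt n) := by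
  have hs := sqrt_natCast_pos hn
  have hns := natCast_eq_sqrt_sq n
  have h := bernProb_pair_linear_le (n := n) hp Set.univ
    (fun _ _ _ => 1) (fun _ _ _ _ => rfl)
    (fun _ _ _ h => absurd (Set.mem_univ _) h) (V := Real.sqrt n ^ 4) (t := ε * Real.sqrt n ^ 5)
    (by positivity) (by positivity)
  have hz : bernProb p (fun _ : Sym2 (Fin n) → Bool =>
      Real.sqrt n ^ 4 < ∑ _k : Fin n, ∑ _j : Fin n, (1 : ℝ) ^ 2) = 0 := by
    refine bernProb_eq_zero fun _ => not_lt.2 (le_of_eq ?_)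
    simp
    nlinarith
  rw [hz, add_zero] at h
  simp only [one_mul] at h
  refine h.trans (le_of_eq ?_)
  congr 2
  field_simp

lemma bernProb_sq_entry_ge (hp : p ∈ Set.Icc (0 : ℝ) 1) (hn : 1 ≤ n) {ε : ℝ} (hε : 0 < ε)
    {i j : Fin n} (hij : i ≠ j) :
    bernProb p (fun ω : Sym2 (Fin n) → Bool =>
        ε * Real.sqrt n ^ 4 ≤ (∑ k, noise p ω i k * noise p ω j k) ^ 2) ≤
      2 * Real.exp (-(ε / 8) * Real.sqrt n) := by
  have hs := sqrt_natCast_pos hn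
  have hns := natCast_eq_sqrt_sq n
  have h := bernProb_pair_linear_le (n := n) hp {e | i ∉ e}
    (fun ω k l => if k = j then noise p ω i l else 0)
    (fun e he ω b => by
      funext k l
      rw [noise_update]
      rintro rfl
      exact he (Sym2.mem_mk_left i l))
    (fun ω k l h => by
      split_ifs with hk
      · subst hk
        have : l = i := by
          by_contra hl
          exact h (by simp [hij, Ne.symm hl])
        rw [this, noise_self]
      · rfl) (V := n) (t := ε * Real.sqrt n ^ 4)
    (by positivity) (by positivity)
  have hz : bernProb p (fun ω : Sym2 (Fin n) → Bool =>
      (n : ℝ) < ∑ k, ∑ l, (if k = j then noise p ω i l else 0) ^ 2) = 0 := by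
    refine bernProb_eq_zero fun ω => not_lt.2 ?_
    simp only [ite_pow, zero_pow two_ne_zero]
    rw [sum_ite_eq_row j (fun k l => noise p ω i l ^ 2)]
    exact (Finset.sum_le_card_nsmul _ _ 1 fun l _ => noise_sq_le hp ω i l).trans (by simp)
  rw [hz, add_zero] at h
  simp only [ite_mul, zero_mul,
    sum_ite_eq_row j (fun k l => noise p _ i l * noise p _ k l)] at h
  refine h.trans (mul_le_mul_of_nonneg_left (Real.exp_le_exp.2 ?_) (by norm_num))
  rw [hns]; simp only [Real.sqrt_sq (Real.sqrt_nonneg _)]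
  have : -(ε * Real.sqrt n ^ 4 / (8 * Real.sqrt n ^ 2)) = -(ε / 8) * Real.sqrt n ^ 2 := by
    field_simp
  rw [this]
  nlinarith [mul_pos hε (by linarith : 0 < Real.sqrt n)]

/-- The off-diagonal part of the squared norm of a masked row-sum vector, decoupled. -/
noncomputable def decoupledNormSq {n : ℕ} (p : ℝ) (m : Sym2 (Fin n) → ℝ)
    (ω δ : Sym2 (Fin n) → Bool) : ℝ :=
  ∑ i, maskedRowSum p (fun e => m e * bit (δ e)) ω i *
    maskedRowSum p (fun e => m e * (1 - bit (δ e))) ω i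

/-- The decoupled cubic form. -/
noncomputable def decoupledCubic {n : ℕ} (p : ℝ) (ω δ : Sym2 (Fin n) → Bool) : ℝ :=
  ∑ i, ∑ j, (1 - bit (δ s(i, j))) * noise p ω i j *
    (maskedRowSum p (fun e => bit (δ e)) ω i * maskedRowSum p (fun e => bit (δ e)) ω j)

lemma abs_bit_le (b : Bool) : |bit b| ≤ 1 := by cases b <;> simp [bit]

lemma abs_one_sub_bit_le (b : Bool) : |1 - bit b| ≤ 1 := by cases b <;> simp [bit]

lemma abs_mul_le_one {x y : ℝ} (hx : |x| ≤ 1) (hy : |y| ≤ 1) : |x * y| ≤ 1 := by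
  rw [abs_mul]; exact mul_le_one₀ hx (abs_nonneg _) hy

lemma half_mem_Icc : (1 / 2 : ℝ) ∈ Set.Icc (0 : ℝ) 1 := by constructor <;> norm_num

lemma bernExp_bit_pair {ι : Type*} [Fintype ι] [DecidableEq ι] (e f : ι) :
    bernExp (1 / 2) (fun δ : ι → Bool => bit (δ e) * (1 - bit (δ f))) =
      if e = f then 0 else 1 / 4 := by
  split_ifs with h
  · subst h
    have : (fun δ : ι → Bool => bit (δ e) * (1 - bit (δ e))) = fun _ => 0 := by
      funext δ; cases δ e <;> simp [bit]
    rw [this, bernExp_const]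
  · rw [bernExp_mul_of_indep e bit (fun δ => 1 - bit (δ f)) fun δ b => by
      rw [Function.update_of_ne (Ne.symm h)]]
    have h2 := bernExp_mul_of_indep (p := 1 / 2) f (fun b => 1 - bit b)
      (fun _ : ι → Bool => 1) fun _ _ => rfl
    simp only [mul_one, bernExp_one] at h2
    rw [h2]
    norm_num [bit]

lemma bernExp_bit_triple {ι : Type*} [Fintype ι] [DecidableEq ι] {e f g : ι} (hfe : f ≠ e)
    (hge : g ≠ e) (hfg : f ≠ g) :
    bernExp (1 / 2) (fun δ : ι → Bool => bit (δ f) * (bit (δ g) * (1 - bit (δ e)))) = 1 / 8 := by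
  rw [bernExp_mul_of_indep f bit (fun δ => bit (δ g) * (1 - bit (δ e))) fun δ b => by
    rw [Function.update_of_ne hfg.symm, Function.update_of_ne hfe.symm], bernExp_bit_pair,
    if_neg hge]
  norm_num [bit]

lemma bernExp_decoupledNormSq (m : Sym2 (Fin n) → ℝ) (ω : Sym2 (Fin n) → Bool) :
    bernExp (1 / 2) (decoupledNormSq p m ω) =
      1 / 4 * (∑ i, maskedRowSum p m ω i ^ 2 - ∑ i, ∑ j, (m s(i, j) * noise p ω i j) ^ 2) := by
  have h1 : decoupledNormSq p m ω = fun δ => ∑ i, ∑ j, ∑ k,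
      (m s(i, j) * noise p ω i j * (m s(i, k) * noise p ω i k)) *
        (bit (δ s(i, j)) * (1 - bit (δ s(i, k)))) := by
    funext δ
    refine Finset.sum_congr rfl fun i _ => ?_
    rw [maskedRowSum, maskedRowSum, Finset.sum_mul_sum]
    exact Finset.sum_congr rfl fun j _ => Finset.sum_congr rfl fun k _ => by ring
  rw [h1, bernExp_sum, ← Finset.sum_sub_distrib, Finset.mul_sum]
  refine Finset.sum_congr rfl fun i _ => ?_
  rw [bernExp_sum, maskedRowSum, sq, Finset.sum_mul_sum, ← Finset.sum_sub_distrib, Finset.mul_sum]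
  refine Finset.sum_congr rfl fun j _ => ?_
  rw [bernExp_sum]
  have h2 : ∀ k, bernExp (1 / 2) (fun δ : Sym2 (Fin n) → Bool =>
      (m s(i, j) * noise p ω i j * (m s(i, k) * noise p ω i k)) *
        (bit (δ s(i, j)) * (1 - bit (δ s(i, k))))) =
      1 / 4 * (m s(i, j) * noise p ω i j * (m s(i, k) * noise p ω i k)) -
        if j = k then 1 / 4 * (m s(i, j) * noise p ω i j) ^ 2 else 0 := by
    intro k
    rw [bernExp_const_mul, bernExp_bit_pair]
    by_cases hjk : j = k
    · subst hjk; simp; ring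
    · rw [if_neg (by rwa [Sym2.congr_right]), if_neg hjk]; ring
  rw [Finset.sum_congr rfl fun k _ => h2 k, Finset.sum_sub_distrib, ← Finset.mul_sum]
  simp
  ring

lemma bernExp_decoupledCubic (ω : Sym2 (Fin n) → Bool) :
    bernExp (1 / 2) (decoupledCubic p ω) =
      1 / 8 * ∑ i, ∑ j, noise p ω i j *
        ((maskedRowSum p (fun _ => 1) ω i - noise p ω i j) *
          (maskedRowSum p (fun _ => 1) ω j - noise p ω i j)) := by
  have h1 : decoupledCubic p ω = fun δ => ∑ i, ∑ j, ∑ k, ∑ l,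
      (noise p ω i j * (noise p ω i k * noise p ω j l)) *
        (bit (δ s(i, k)) * (bit (δ s(j, l)) * (1 - bit (δ s(i, j))))) := by
    funext δ
    refine Finset.sum_congr rfl fun i _ => Finset.sum_congr rfl fun j _ => ?_
    rw [maskedRowSum, maskedRowSum, Finset.sum_mul_sum, Finset.mul_sum]
    refine Finset.sum_congr rfl fun k _ => ?_
    rw [Finset.mul_sum]
    exact Finset.sum_congr rfl fun l _ => by ring
  rw [h1, bernExp_sum, Finset.mul_sum]
  refine Finset.sum_congr rfl fun i _ => ?_
  rw [bernExp_sum, Finset.mul_sum]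
  refine Finset.sum_congr rfl fun j _ => ?_
  by_cases hij : i = j
  · subst hij; simp [noise_self, bernExp_const]
  have h2 : ∀ k l, bernExp (1 / 2) (fun δ : Sym2 (Fin n) → Bool =>
      (noise p ω i j * (noise p ω i k * noise p ω j l)) *
        (bit (δ s(i, k)) * (bit (δ s(j, l)) * (1 - bit (δ s(i, j)))))) =
      1 / 8 * noise p ω i j * ((noise p ω i k - if j = k then noise p ω i k else 0) *
        (noise p ω j l - if i = l then noise p ω j l else 0)) := by
    intro k l
    rw [bernExp_const_mul]
    by_cases hjk : j = k
    · subst hjk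
      have : (fun δ : Sym2 (Fin n) → Bool =>
          bit (δ s(i, j)) * (bit (δ s(j, l)) * (1 - bit (δ s(i, j))))) = fun _ => 0 := by
        funext δ; cases δ s(i, j) <;> simp [bit]
      rw [this, bernExp_const]; simp
    by_cases hil : i = l
    · subst hil
      have : (fun δ : Sym2 (Fin n) → Bool =>
          bit (δ s(i, k)) * (bit (δ s(j, i)) * (1 - bit (δ s(i, j))))) = fun _ => 0 := by
        funext δ; rw [Sym2.eq_swap (a := j)]; cases δ s(i, j) <;> simp [bit]
      rw [this, bernExp_const]; simp
    rw [bernExp_bit_triple]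
    · simp [hjk, hil]; ring
    · rw [Ne, Sym2.congr_right]; exact Ne.symm hjk
    · rw [Sym2.eq_swap (a := i), Ne, Sym2.congr_right]; exact Ne.symm hil
    · simp [hij, hil]
  simp only [bernExp_sum, h2]
  simp only [← Finset.mul_sum, ← Finset.sum_mul]
  simp only [Finset.sum_sub_distrib, Finset.sum_ite_eq, Finset.mem_univ, if_true, maskedRowSum,
    one_mul]
  rw [noise_comm ω j i]
  ring

end Tails

section TypicalNoise

variable {n : ℕ} {p : ℝ}

/-- The exponential rate shared by the elementary tail bounds. -/
noncomputable def rowTail (n : ℕ) : ℝ := 2 * Real.exp (-(1 / 8) * Real.sqrt n)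

/-- A bound for the probability that a masked row-sum vector is long. -/
noncomputable def normTail (n : ℕ) : ℝ := n * (rowTail n + n * rowTail n)

/-- A bound for the probability that the decoupled cubic form is large. -/
noncomputable def cubicTail (ε : ℝ) (n : ℕ) : ℝ :=
  2 * Real.exp (-(ε ^ 2 / 648) * Real.sqrt n) + normTail n

lemma stretchedExpBound_rowTail : StretchedExpBound rowTail := .exp_neg (by norm_num) 2

lemma stretchedExpBound_normTail : StretchedExpBound normTail :=
  (stretchedExpBound_rowTail.add stretchedExpBound_rowTail.natCast_mul).natCast_mul

lemma stretchedExpBound_cubicTail {ε : ℝ} (hε : 0 < ε) : StretchedExpBound (cubicTail ε) :=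
  (StretchedExpBound.exp_neg (by positivity) 2).add stretchedExpBound_normTail

lemma normTail_nonneg (n : ℕ) : 0 ≤ normTail n := by unfold normTail rowTail; positivity

lemma cubicTail_nonneg (ε : ℝ) (n : ℕ) : 0 ≤ cubicTail ε n :=
  add_nonneg (by positivity) (normTail_nonneg n)

lemma bernProb_exists_fin_le (hp : p ∈ Set.Icc (0 : ℝ) 1) {P : Fin n → (Sym2 (Fin n) → Bool) → Prop}
    {q : ℝ} (h : ∀ i, bernProb p (P i) ≤ q) : bernProb p (fun ω => ∃ i, P i ω) ≤ n * q := by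
  refine (bernProb_exists_le hp P).trans ((Finset.sum_le_card_nsmul _ _ q fun i _ => h i).trans ?_)
  simp

lemma bernProb_decoupledNormSq_ge (hp : p ∈ Set.Icc (0 : ℝ) 1) (hn : 1 ≤ n)
    {m : Sym2 (Fin n) → ℝ} (hm : ∀ e, |m e| ≤ 1) (δ : Sym2 (Fin n) → Bool) :
    bernProb p (fun ω => Real.sqrt n ^ 4 ≤ |decoupledNormSq p m ω δ|) ≤
      rowTail n + n * rowTail n := by
  have hs := sqrt_natCast_pos hn
  have hns := natCast_eq_sqrt_sq n
  set m' : Sym2 (Fin n) → ℝ := fun e => m e * bit (δ e) with hm'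
  have hm1 : ∀ e, |m' e| ≤ 1 := fun e => abs_mul_le_one (hm e) (abs_bit_le _)
  have h := bernProb_pair_linear_le (n := n) hp {e | δ e = false}
    (fun ω i j => maskedRowSum p m' ω i * (m s(i, j) * (1 - bit (δ s(i, j)))))
    (fun e he ω b => by
      have he' : m' e = 0 := by
        have he'' : δ e = false := he
        simp [hm', he'', bit]
      simp only [maskedRowSum_update m' ω b he'])
    (fun ω i j h => by
      have : δ s(i, j) = true := by simpa using h
      simp [this, bit]) (V := Real.sqrt n ^ 7) (t := Real.sqrt n ^ 8)
    (by positivity) (by positivity)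
  have e1 : ∀ ω, ∑ i, ∑ j, maskedRowSum p m' ω i * (m s(i, j) * (1 - bit (δ s(i, j)))) *
      noise p ω i j = decoupledNormSq p m ω δ := by
    intro ω
    refine Finset.sum_congr rfl fun i _ => ?_
    rw [maskedRowSum, maskedRowSum, Finset.mul_sum]
    exact Finset.sum_congr rfl fun j _ => by ring
  simp only [e1] at h
  refine (bernProb_mono hp fun ω hω => ?_).trans (h.trans (add_le_add (le_of_eq ?_) ?_))
  · rw [← sq_abs]
    calc Real.sqrt n ^ 8 = (Real.sqrt n ^ 4) ^ 2 := by ring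
      _ ≤ _ := pow_le_pow_left₀ (by positivity) hω 2
  · rw [rowTail]; congr 2; field_simp
  · refine le_trans (bernProb_mono hp (fun ω hω => ?_))
      (bernProb_exists_fin_le hp fun i => bernProb_row_ge hp hn hm1 i)
    by_contra! hcon
    refine absurd hω (not_lt.2 ?_)
    calc ∑ i, ∑ j, (maskedRowSum p m' ω i * (m s(i, j) * (1 - bit (δ s(i, j))))) ^ 2
        ≤ ∑ _i : Fin n, ∑ _j : Fin n, Real.sqrt n ^ 3 := by
          refine Finset.sum_le_sum fun i _ => Finset.sum_le_sum fun j _ => ?_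
          rw [mul_pow]
          have := (sq_le_one_iff_abs_le_one _).2
            (abs_mul_le_one (hm s(i, j)) (abs_one_sub_bit_le (δ s(i, j))))
          exact (mul_le_of_le_one_right (sq_nonneg _) this).trans (hcon i).le
      _ = Real.sqrt n ^ 7 := by
          simp only [Finset.sum_const, Finset.card_univ, Fintype.card_fin, nsmul_eq_mul]
          rw [hns]; simp only [Real.sqrt_sq (Real.sqrt_nonneg _)]; ring

lemma bernProb_normSq_ge (hp : p ∈ Set.Icc (0 : ℝ) 1) (hn : 1 ≤ n)
    {m : Sym2 (Fin n) → ℝ} (hm : ∀ e, |m e| ≤ 1) :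
    bernProb p (fun ω => 9 * Real.sqrt n ^ 4 ≤ ∑ i, maskedRowSum p m ω i ^ 2) ≤ normTail n := by
  have hs := sqrt_natCast_pos hn
  have hns := natCast_eq_sqrt_sq n
  have h := bernProb_average_le hp half_mem_Icc (decoupledNormSq p m) (t := Real.sqrt n ^ 4)
    (M := Real.sqrt n ^ 6) (by positivity) (by positivity)
    (fun ω δ => by
      refine (Finset.abs_sum_le_sum_abs _ _).trans ?_
      refine (Finset.sum_le_card_nsmul _ _ ((n : ℝ) * n) fun i _ => ?_).trans (le_of_eq ?_)
      · rw [abs_mul]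
        exact mul_le_mul
          (abs_maskedRowSum_le hp (fun e => abs_mul_le_one (hm e) (abs_bit_le _)) ω i)
          (abs_maskedRowSum_le hp (fun e => abs_mul_le_one (hm e) (abs_one_sub_bit_le _)) ω i)
          (abs_nonneg _) (Nat.cast_nonneg n)
      · simp only [Finset.card_univ, Fintype.card_fin, nsmul_eq_mul]
        rw [hns]; simp only [Real.sqrt_sq (Real.sqrt_nonneg _)]; ring)
    (bernProb_decoupledNormSq_ge hp hn hm)
  refine (bernProb_mono hp fun ω hω => ?_).trans (h.trans (le_of_eq ?_))
  · rw [bernExp_decoupledNormSq]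
    have hd : ∑ i, ∑ j, (m s(i, j) * noise p ω i j) ^ 2 ≤ Real.sqrt n ^ 4 := by
      calc ∑ i, ∑ j, (m s(i, j) * noise p ω i j) ^ 2 ≤ ∑ _i : Fin n, ∑ _j : Fin n, (1 : ℝ) :=
            Finset.sum_le_sum fun i _ => Finset.sum_le_sum fun j _ =>
              (sq_le_one_iff_abs_le_one _).2 (abs_mul_le_one (hm _) (abs_noise_le hp ω i j))
        _ = Real.sqrt n ^ 4 := by simp; nlinarith
    refine le_trans ?_ (le_abs_self _)
    linarith
  · rw [normTail]
    congr 1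
    rw [hns]; simp only [Real.sqrt_sq (Real.sqrt_nonneg _)]
    field_simp

lemma bernProb_decoupledCubic_ge (hp : p ∈ Set.Icc (0 : ℝ) 1) (hn : 1 ≤ n) {ε : ℝ} (hε : 0 < ε)
    (δ : Sym2 (Fin n) → Bool) :
    bernProb p (fun ω => ε * Real.sqrt n ^ 5 ≤ |decoupledCubic p ω δ|) ≤ cubicTail ε n := by
  have hs := sqrt_natCast_pos hn
  set m' : Sym2 (Fin n) → ℝ := fun e => bit (δ e) with hm'
  have hm1 : ∀ e, |m' e| ≤ 1 := fun e => abs_bit_le _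
  have h := bernProb_pair_linear_le (n := n) hp {e | δ e = false}
    (fun ω i j => (1 - bit (δ s(i, j))) * (maskedRowSum p m' ω i * maskedRowSum p m' ω j))
    (fun e he ω b => by
      have he' : m' e = 0 := by
        have he'' : δ e = false := he
        simp [hm', he'', bit]
      simp only [maskedRowSum_update m' ω b he'])
    (fun ω i j h => by
      have : δ s(i, j) = true := by simpa using h
      simp [this, bit]) (V := 81 * Real.sqrt n ^ 8) (t := ε ^ 2 * Real.sqrt n ^ 10)
    (by positivity) (by positivity)
  have e1 : ∀ ω, ∑ i, ∑ j, (1 - bit (δ s(i, j))) *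
      (maskedRowSum p m' ω i * maskedRowSum p m' ω j) * noise p ω i j = decoupledCubic p ω δ :=
    fun ω => Finset.sum_congr rfl fun i _ => Finset.sum_congr rfl fun j _ => by ring
  simp only [e1] at h
  refine (bernProb_mono hp fun ω hω => ?_).trans (h.trans (add_le_add ?_ ?_))
  · rw [← sq_abs (decoupledCubic p ω δ)]
    calc ε ^ 2 * Real.sqrt n ^ 10 = (ε * Real.sqrt n ^ 5) ^ 2 := by ring
      _ ≤ _ := pow_le_pow_left₀ (by positivity) hω 2
  · refine mul_le_mul_of_nonneg_left (Real.exp_le_exp.2 ?_) (by norm_num)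
    have : -(ε ^ 2 * Real.sqrt n ^ 10 / (8 * (81 * Real.sqrt n ^ 8))) =
        -(ε ^ 2 / 648) * Real.sqrt n ^ 2 := by field_simp; norm_num
    rw [this]
    have h1 : Real.sqrt n ≤ Real.sqrt n ^ 2 := by nlinarith
    have h2 : 0 ≤ ε ^ 2 / 648 := by positivity
    nlinarith
  · refine le_trans (bernProb_mono hp (fun ω hω => ?_)) (bernProb_normSq_ge hp hn hm1)
    by_contra! hcon
    refine absurd hω (not_lt.2 ?_)
    have h0 : 0 ≤ ∑ i, maskedRowSum p m' ω i ^ 2 := Finset.sum_nonneg fun _ _ => sq_nonneg _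
    calc ∑ i, ∑ j, ((1 - bit (δ s(i, j))) * (maskedRowSum p m' ω i * maskedRowSum p m' ω j)) ^ 2
        ≤ ∑ i, ∑ j, maskedRowSum p m' ω i ^ 2 * maskedRowSum p m' ω j ^ 2 := by
          refine Finset.sum_le_sum fun i _ => Finset.sum_le_sum fun j _ => ?_
          rw [mul_pow, mul_pow]
          exact mul_le_of_le_one_left (by positivity)
            ((sq_le_one_iff_abs_le_one _).2 (abs_one_sub_bit_le _))
      _ = (∑ i, maskedRowSum p m' ω i ^ 2) ^ 2 := by rw [sq, Finset.sum_mul_sum]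
      _ ≤ 81 * Real.sqrt n ^ 8 := by
          refine (pow_le_pow_left₀ h0 hcon.le 2).trans (le_of_eq (by ring))

lemma bernProb_average_cubic_ge (hp : p ∈ Set.Icc (0 : ℝ) 1) (hn : 1 ≤ n) {ε : ℝ} (hε : 0 < ε) :
    bernProb p (fun ω : Sym2 (Fin n) → Bool =>
      2 * (ε * Real.sqrt n ^ 5) ≤ |bernExp (1 / 2) (decoupledCubic p ω)|) ≤
      1 / ε * (n * (n * cubicTail ε n)) := by
  have hs := sqrt_natCast_pos hn
  have hns := natCast_eq_sqrt_sq n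
  have h := bernProb_average_le hp half_mem_Icc (decoupledCubic (n := n) p)
    (t := ε * Real.sqrt n ^ 5)
    (M := Real.sqrt n ^ 8) (by positivity) (by positivity)
    (fun ω δ => by
      refine (Finset.abs_sum_le_sum_abs _ _).trans ?_
      refine (Finset.sum_le_card_nsmul _ _ (n * ((n : ℝ) * n)) fun i _ => ?_).trans (le_of_eq ?_)
      · refine (Finset.abs_sum_le_sum_abs _ _).trans ?_
        refine (Finset.sum_le_card_nsmul _ _ ((n : ℝ) * n) fun j _ => ?_).trans (by simp)
        rw [abs_mul, abs_mul (maskedRowSum _ _ _ _)]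
        refine (mul_le_of_le_one_left (by positivity)
          (abs_mul_le_one (abs_one_sub_bit_le _) (abs_noise_le hp ω i j))).trans ?_
        exact mul_le_mul
          (abs_maskedRowSum_le hp (fun e => abs_bit_le _) ω i)
          (abs_maskedRowSum_le hp (fun e => abs_bit_le _) ω j)
          (abs_nonneg _) (Nat.cast_nonneg n)
      · simp only [Finset.card_univ, Fintype.card_fin, nsmul_eq_mul]
        rw [hns]; simp only [Real.sqrt_sq (Real.sqrt_nonneg _)]; ring)
    (bernProb_decoupledCubic_ge hp hn hε)
  refine h.trans ?_
  have hq := cubicTail_nonneg ε n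
  have e1 : (n : ℝ) * (n * cubicTail ε n) = Real.sqrt n ^ 4 * cubicTail ε n := by
    nth_rewrite 1 [hns]; nth_rewrite 2 [hns]; ring
  have e2 : Real.sqrt n ^ 8 / (ε * Real.sqrt n ^ 5) = 1 / ε * Real.sqrt n ^ 3 := by field_simp
  rw [e1, e2, mul_assoc]
  refine mul_le_mul_of_nonneg_left (mul_le_mul_of_nonneg_right ?_ hq) (by positivity)
  exact pow_le_pow_right₀ hs (by norm_num)

/-- The mask removing the edges at a vertex. -/
noncomputable def awayMask {n : ℕ} (i : Fin n) (e : Sym2 (Fin n)) : ℝ := if i ∈ e then 0 else 1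

lemma abs_awayMask_le (i : Fin n) (e : Sym2 (Fin n)) : |awayMask i e| ≤ 1 := by
  unfold awayMask; split_ifs <;> simp

lemma bernProb_row_away_ge (hp : p ∈ Set.Icc (0 : ℝ) 1) (hn : 1 ≤ n) {ε : ℝ} (hε : 0 < ε)
    (i : Fin n) :
    bernProb p (fun ω => ε * Real.sqrt n ^ 5 ≤
        (∑ j, maskedRowSum p (awayMask i) ω j * noise p ω i j) ^ 2) ≤
      2 * Real.exp (-(ε / 72) * Real.sqrt n) + normTail n := by
  have hs := sqrt_natCast_pos hn
  have h := bernProb_pair_linear_le (n := n) hp {e | i ∈ e}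
    (fun ω k j => if k = i then maskedRowSum p (awayMask i) ω j else 0)
    (fun e he ω b => by
      have he' : awayMask i e = 0 := if_pos he
      simp only [maskedRowSum_update (awayMask i) ω b he'])
    (fun ω k j h => by
      refine if_neg fun hk => h ?_
      subst hk
      exact Sym2.mem_mk_left k j) (V := 9 * Real.sqrt n ^ 4) (t := ε * Real.sqrt n ^ 5)
    (by positivity) (by positivity)
  simp only [ite_mul, zero_mul, ite_pow, zero_pow two_ne_zero,
    sum_ite_eq_row i (fun k j => maskedRowSum p (awayMask i) _ j * noise p _ k j),
    sum_ite_eq_row i (fun k j => maskedRowSum p (awayMask i) _ j ^ 2)] at h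
  refine h.trans (add_le_add (le_of_eq ?_) ?_)
  · congr 2; field_simp; norm_num
  · exact (bernProb_mono hp fun ω hω => hω.le).trans (bernProb_normSq_ge hp hn (abs_awayMask_le i))

/-- The high-probability bounds on the noise matrix. -/
structure TypicalNoise (p ε : ℝ) {n : ℕ} (ω : Sym2 (Fin n) → Bool) : Prop where
  normSq : ∑ i, maskedRowSum p (fun _ => 1) ω i ^ 2 ≤ 9 * Real.sqrt n ^ 4
  total : (∑ i, ∑ j, noise p ω i j) ^ 2 ≤ ε * Real.sqrt n ^ 5
  cubic : |bernExp (1 / 2) (decoupledCubic p ω)| ≤ 2 * (ε * Real.sqrt n ^ 5)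
  away : ∀ i, (∑ j, maskedRowSum p (awayMask i) ω j * noise p ω i j) ^ 2 ≤ ε * Real.sqrt n ^ 5
  entry : ∀ i j, i ≠ j → (∑ k, noise p ω i k * noise p ω j k) ^ 2 ≤ ε ^ 2 * Real.sqrt n ^ 4

lemma exists_bound_not_typicalNoise (hp : p ∈ Set.Icc (0 : ℝ) 1) {ε : ℝ} (hε : 0 < ε) :
    ∃ q : ℕ → ℝ, StretchedExpBound q ∧ ∀ n : ℕ, 1 ≤ n →
      bernProb p (fun ω : Sym2 (Fin n) → Bool => ¬ TypicalNoise p ε ω) ≤ q n := by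
  have hε2 : 0 < ε ^ 2 := by positivity
  refine ⟨_, stretchedExpBound_normTail.add
    ((StretchedExpBound.exp_neg (c := ε / 8) (by positivity) 2).add
    ((((stretchedExpBound_cubicTail hε).natCast_mul.natCast_mul).const_mul
      (c := 1 / ε) (by positivity)).add
    ((((StretchedExpBound.exp_neg (c := ε / 72) (by positivity) 2).add
      stretchedExpBound_normTail).natCast_mul).add
    (StretchedExpBound.exp_neg (c := ε ^ 2 / 8) (by positivity) 2).natCast_mul.natCast_mul))),
    fun n hn => ?_⟩
  refine (bernProb_mono hp (Q := fun ω =>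
    (9 * Real.sqrt n ^ 4 ≤ ∑ i, maskedRowSum p (fun _ => 1) ω i ^ 2) ∨
    (ε * Real.sqrt n ^ 5 ≤ (∑ i, ∑ j, noise p ω i j) ^ 2) ∨
    (2 * (ε * Real.sqrt n ^ 5) ≤ |bernExp (1 / 2) (decoupledCubic p ω)|) ∨
    (∃ i, ε * Real.sqrt n ^ 5 ≤ (∑ j, maskedRowSum p (awayMask i) ω j * noise p ω i j) ^ 2) ∨
    (∃ i, ∃ j, i ≠ j ∧ ε ^ 2 * Real.sqrt n ^ 4 ≤
      (∑ k, noise p ω i k * noise p ω j k) ^ 2)) fun ω hω => ?_).trans ?_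
  · by_contra! h
    exact hω ⟨h.1.le, h.2.1.le, h.2.2.1.le, fun i => (h.2.2.2.1 i).le,
      fun i j hij => (h.2.2.2.2 i j hij).le⟩
  · refine (bernProb_or_le hp _ _).trans (add_le_add (bernProb_normSq_ge hp hn (by simp)) ?_)
    refine (bernProb_or_le hp _ _).trans (add_le_add (bernProb_total_ge hp hn hε) ?_)
    refine (bernProb_or_le hp _ _).trans (add_le_add (bernProb_average_cubic_ge hp hn hε) ?_)
    refine (bernProb_or_le hp _ _).trans (add_le_add
      (bernProb_exists_fin_le hp (bernProb_row_away_ge hp hn hε)) ?_)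
    refine bernProb_exists_fin_le hp fun i => bernProb_exists_fin_le hp fun j => ?_
    by_cases hij : i = j
    · rw [bernProb_eq_zero fun ω h => h.1 hij]; positivity
    · exact (bernProb_mono hp fun ω h => h.2).trans (bernProb_sq_entry_ge hp hn hε2 hij)

end TypicalNoise

/-! ### Random graphs from Bernoulli variables -/

/-- The graph whose edges are the off-diagonal pairs with outcome `true`. -/
def graphOf {n : ℕ} (ω : Sym2 (Fin n) → Bool) : SimpleGraph (Fin n) :=
  SimpleGraph.fromEdgeSet {e | ω e = true}

section GraphOf

variable {n : ℕ} {p : ℝ}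

lemma graphOf_eq_iff (ω : Sym2 (Fin n) → Bool) (g : SimpleGraph (Fin n)) :
    graphOf ω = g ↔ ∀ e : Sym2 (Fin n), ¬ e.IsDiag → (ω e = true ↔ e ∈ g.edgeSet) := by
  rw [graphOf, ← SimpleGraph.edgeSet_inj, SimpleGraph.edgeSet_fromEdgeSet, Set.ext_iff]
  refine forall_congr' fun e => ?_
  by_cases he : e.IsDiag
  · have : e ∉ g.edgeSet := fun h => g.not_isDiag_of_mem_edgeSet h he
    simp [he, this]
  · simp [he]

lemma card_not_isDiag (n : ℕ) :
    (Finset.univ.filter fun e : Sym2 (Fin n) => ¬ e.IsDiag).card = n.choose 2 := by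
  have h := Sym2.card_subtype_not_diag (α := Fin n)
  rw [Fintype.card_subtype, Fintype.card_fin] at h
  convert h

lemma bernProb_graphOf_eq (g : SimpleGraph (Fin n)) :
    bernProb p (fun ω => graphOf ω = g) = erWeight n p g := by
  let φ (e : Sym2 (Fin n)) (b : Bool) : ℝ :=
    if e.IsDiag ∨ (b = true ↔ e ∈ g.edgeSet) then 1 else 0
  have h1 : (fun ω : Sym2 (Fin n) → Bool => if graphOf ω = g then (1 : ℝ) else 0) =
      fun ω => ∏ e, φ e (ω e) := by
    funext ω
    simp only [φ]
    rw [Finset.prod_ite_zero, graphOf_eq_iff]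
    simp only [Finset.mem_univ, true_imp_iff, Finset.prod_const_one, or_iff_not_imp_left]
    congr
  rw [bernProb, h1, bernExp_prod]
  have h2 : ∀ e : Sym2 (Fin n),
      p * φ e true + (1 - p) * φ e false =
      (if e ∈ g.edgeFinset then p else 1) *
        (if e ∈ (Finset.univ.filter fun e : Sym2 (Fin n) => ¬ e.IsDiag) \ g.edgeFinset
          then 1 - p else 1) := by
    intro e
    by_cases he : e.IsDiag
    · have : e ∉ g.edgeSet := fun h => g.not_isDiag_of_mem_edgeSet h he
      simp [φ, he, this]
    · by_cases hg : e ∈ g.edgeSet <;> simp [φ, he, hg]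
  have h3 : g.edgeFinset ⊆ Finset.univ.filter fun e : Sym2 (Fin n) => ¬ e.IsDiag := fun e he => by
    simpa using g.not_isDiag_of_mem_edgeSet (SimpleGraph.mem_edgeFinset.1 he)
  rw [Finset.prod_congr rfl fun e _ => h2 e, Finset.prod_mul_distrib, Finset.prod_ite_mem,
    Finset.prod_ite_mem, Finset.univ_inter, Finset.univ_inter, Finset.prod_const, Finset.prod_const,
    Finset.card_sdiff_of_subset h3, card_not_isDiag, erWeight, edgeCount]

lemma erProb_eq_bernProb (S : Set (SimpleGraph (Fin n))) :
    erProb n p S = bernProb p (fun ω => graphOf ω ∈ S) := by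
  have h : (fun ω : Sym2 (Fin n) → Bool => if graphOf ω ∈ S then (1 : ℝ) else 0) =
      fun ω => ∑ g : SimpleGraph (Fin n),
        (if g ∈ S then 1 else 0) * (if graphOf ω = g then 1 else 0) := by
    funext ω
    simp
  rw [bernProb, h, bernExp_sum, erProb]
  refine Finset.sum_congr rfl fun g _ => ?_
  rw [bernExp_const_mul, ← bernProb, bernProb_graphOf_eq]
  split_ifs <;> simp

lemma adjMat_graphOf (ω : Sym2 (Fin n) → Bool) (i j : Fin n) :
    adjMat (graphOf ω) i j = noise p ω i j + if i = j then 0 else p := by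
  rw [adjMat, SimpleGraph.adjMatrix_apply]
  by_cases hij : i = j <;> by_cases hω : ω s(i, j) = true <;>
    simp [graphOf, noise, centred, hij, hω]

end GraphOf

/-! ### The largest eigenvalue as a Rayleigh quotient -/

section Rayleigh

open Matrix
open scoped Pointwise

variable {n : ℕ} {M : Matrix (Fin n) (Fin n) ℝ}

lemma forall_spectrum_le_iff (hM : M.IsHermitian) (c : ℝ) :
    (∀ μ ∈ spectrum ℝ M, μ ≤ c) ↔ ∀ x, x ⬝ᵥ M *ᵥ x ≤ c * (x ⬝ᵥ x) := by
  have hH : (algebraMap ℝ (Matrix (Fin n) (Fin n) ℝ) c - M).IsHermitian := by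
    refine IsHermitian.sub ?_ hM
    rw [Algebra.algebraMap_eq_smul_one, IsHermitian, conjTranspose_smul]
    simp
  have h1 := posSemidef_iff_isHermitian_and_spectrum_nonneg
    (A := algebraMap ℝ (Matrix (Fin n) (Fin n) ℝ) c - M)
  have h2 := posSemidef_iff_dotProduct_mulVec (M := algebraMap ℝ (Matrix (Fin n) (Fin n) ℝ) c - M)
  rw [h1] at h2
  simp only [hH, true_and] at h2
  rw [← spectrum.singleton_sub_eq] at h2
  have h3 : (∀ μ ∈ spectrum ℝ M, μ ≤ c) ↔ ({c} : Set ℝ) - spectrum ℝ M ⊆ {a : ℝ | 0 ≤ a} := by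
    constructor
    · rintro h _ ⟨a, ha, b, hb, rfl⟩
      obtain rfl : a = c := ha
      exact sub_nonneg.2 (h b hb)
    · exact fun h μ hμ => sub_nonneg.1 (h ⟨c, rfl, μ, hμ, rfl⟩)
  rw [h3, h2]
  refine forall_congr' fun x => ?_
  rw [Algebra.algebraMap_eq_smul_one, sub_mulVec, smul_mulVec, one_mulVec, dotProduct_sub,
    dotProduct_smul, sub_nonneg, smul_eq_mul, star_trivial]

lemma dotProduct_mulVec_le_lam1 (hM : M.IsHermitian) (x : Fin n → ℝ) :
    x ⬝ᵥ M *ᵥ x ≤ lam1 M * (x ⬝ᵥ x) :=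
  (forall_spectrum_le_iff hM _).1 (fun _ hμ => le_csSup M.finite_real_spectrum.bddAbove hμ) x

lemma lam1_le [NeZero n] (hM : M.IsHermitian) {c : ℝ} (h : ∀ x, x ⬝ᵥ M *ᵥ x ≤ c * (x ⬝ᵥ x)) :
    lam1 M ≤ c :=
  csSup_le ⟨_, hM.eigenvalues_mem_spectrum_real 0⟩ ((forall_spectrum_le_iff hM c).2 h)

/-- A quadratic form which is small orthogonally to an approximate eigenvector `K` is at most the
Rayleigh quotient of `K` plus a term quadratic in the residual. -/
lemma lam1_le_of_residual [NeZero n] (hM : M.IsHermitian) {K e : Fin n → ℝ} {d ρ μ τ : ℝ}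
    (hK : M *ᵥ K = d • K + e) (hρ : K ⬝ᵥ M *ᵥ K = ρ * (K ⬝ᵥ K)) (hpos : 0 < K ⬝ᵥ K) (hμ : μ < ρ)
    (hw : ∀ w, w ⬝ᵥ K = 0 → w ⬝ᵥ M *ᵥ w ≤ μ * (w ⬝ᵥ w)) (hτ : 0 ≤ τ)
    (he : e ⬝ᵥ e ≤ τ * (K ⬝ᵥ K) * (ρ - μ)) : lam1 M ≤ ρ + τ := by
  refine lam1_le hM fun x => ?_
  set a := (x ⬝ᵥ K) / (K ⬝ᵥ K) with ha
  set w := x - a • K with hwdef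
  have hx : x = a • K + w := by simp [hwdef]
  have hwK : w ⬝ᵥ K = 0 := by
    rw [hwdef, sub_dotProduct, smul_dotProduct, smul_eq_mul, ha, div_mul_cancel₀ _ hpos.ne', sub_self]
  have hKw : K ⬝ᵥ w = 0 := by rw [dotProduct_comm, hwK]
  have hwMK : w ⬝ᵥ M *ᵥ K = w ⬝ᵥ e := by
    rw [hK, dotProduct_add, dotProduct_smul, hwK, smul_zero, zero_add]
  have hKMw : K ⬝ᵥ M *ᵥ w = w ⬝ᵥ e := by
    have hT : Mᵀ = M := by rw [← conjTranspose_eq_transpose_of_trivial]; exact hM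
    rw [dotProduct_mulVec, ← mulVec_transpose, hT, dotProduct_comm, hwMK]
  have hquad : x ⬝ᵥ M *ᵥ x = a ^ 2 * (ρ * (K ⬝ᵥ K)) + 2 * a * (w ⬝ᵥ e) + w ⬝ᵥ M *ᵥ w := by
    rw [hx]
    simp only [mulVec_add, mulVec_smul, add_dotProduct, dotProduct_add, smul_dotProduct,
      dotProduct_smul, smul_eq_mul, hwMK, hKMw, hρ]
    ring
  have hnorm : x ⬝ᵥ x = a ^ 2 * (K ⬝ᵥ K) + w ⬝ᵥ w := by
    rw [hx]
    simp only [add_dotProduct, dotProduct_add, smul_dotProduct, dotProduct_smul, smul_eq_mul,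
      hwK, hKw]
    ring
  have hc : 0 < ρ - μ := sub_pos.2 hμ
  have hsq : 0 ≤ ((ρ - μ) • w - a • e) ⬝ᵥ ((ρ - μ) • w - a • e) :=
    Finset.sum_nonneg fun i _ => mul_self_nonneg _
  have hsq' : ((ρ - μ) • w - a • e) ⬝ᵥ ((ρ - μ) • w - a • e) =
      (ρ - μ) ^ 2 * (w ⬝ᵥ w) - 2 * (ρ - μ) * a * (w ⬝ᵥ e) + a ^ 2 * (e ⬝ᵥ e) := by
    simp only [sub_dotProduct, dotProduct_sub, smul_dotProduct, dotProduct_smul, smul_eq_mul,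
      dotProduct_comm e w]
    ring
  have hcross : 2 * a * (w ⬝ᵥ e) ≤ (ρ - μ) * (w ⬝ᵥ w) + a ^ 2 * (τ * (K ⬝ᵥ K)) := by
    have h1 := mul_le_mul_of_nonneg_left he (sq_nonneg a)
    refine le_of_mul_le_mul_left ?_ hc
    nlinarith
  have hww : 0 ≤ w ⬝ᵥ w := Finset.sum_nonneg fun i _ => mul_self_nonneg _
  have := hw w hwK
  have := mul_nonneg hτ hww
  rw [hquad, hnorm]
  nlinarith

end Rayleigh

/-! ### Deterministic estimates for typical noise -/

namespace TypicalNoise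

variable {n : ℕ} {p ε : ℝ} {ω : Sym2 (Fin n) → Bool}

lemma sum_mul_noise_sq_le (hp : p ∈ Set.Icc (0 : ℝ) 1) (h : TypicalNoise p ε ω) (hε : 0 ≤ ε)
    (hs : 1 ≤ ε * Real.sqrt n) (hs1 : 1 ≤ Real.sqrt n) (x : Fin n → ℝ) :
    ∑ i, (∑ j, noise p ω i j * x j) ^ 2 ≤ 2 * ε * Real.sqrt n ^ 4 * ∑ i, x i ^ 2 := by
  set s := Real.sqrt n with hsdef
  have hn : (n : ℝ) = s ^ 2 := natCast_eq_sqrt_sq n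
  have hX : 0 ≤ ∑ i, x i ^ 2 := Finset.sum_nonneg fun i _ => sq_nonneg _
  have hexp : ∑ i, (∑ j, noise p ω i j * x j) ^ 2 =
      ∑ j, ∑ k, x j * x k * ∑ i, noise p ω j i * noise p ω k i := by
    simp only [sq, Finset.sum_mul_sum]
    simp only [Finset.mul_sum]
    rw [Finset.sum_comm]
    refine Finset.sum_congr rfl fun j _ => ?_
    rw [Finset.sum_comm]
    refine Finset.sum_congr rfl fun k _ => Finset.sum_congr rfl fun i _ => ?_
    rw [noise_comm ω j i, noise_comm ω k i]
    ring
  have hterm : ∀ j k, x j * x k * ∑ i, noise p ω j i * noise p ω k i ≤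
      (if j = k then s ^ 2 * x j ^ 2 else 0) + ε * s ^ 2 * (|x j| * |x k|) := by
    intro j k
    by_cases hjk : j = k
    · subst hjk
      have h1 : ∑ i, noise p ω j i * noise p ω j i ≤ s ^ 2 := by
        refine (Finset.sum_le_sum fun i _ => (sq (noise p ω j i)).symm.le.trans
          (noise_sq_le hp ω j i)).trans ?_
        simp [hn]
      have h2 := mul_le_mul_of_nonneg_left h1 (sq_nonneg (x j))
      have h3 : 0 ≤ ε * s ^ 2 * (|x j| * |x j|) := by positivity
      rw [if_pos rfl]
      nlinarith
    · rw [if_neg hjk, zero_add]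
      have h1 : |∑ i, noise p ω j i * noise p ω k i| ≤ ε * s ^ 2 :=
        abs_le_of_sq_le_sq (by rw [mul_pow, ← pow_mul]; exact h.entry j k hjk) (by positivity)
      refine (le_abs_self _).trans ?_
      rw [abs_mul, abs_mul, mul_comm]
      exact mul_le_mul_of_nonneg_right h1 (by positivity)
  have hl1 : (∑ i, |x i|) ^ 2 ≤ s ^ 2 * ∑ i, x i ^ 2 := by
    have := sq_sum_le_card_mul_sum_sq (s := Finset.univ) (f := fun i => |x i|)
    simpa [hn] using this
  calc ∑ i, (∑ j, noise p ω i j * x j) ^ 2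
      ≤ ∑ j, ∑ k, ((if j = k then s ^ 2 * x j ^ 2 else 0) + ε * s ^ 2 * (|x j| * |x k|)) := by
        rw [hexp]
        exact Finset.sum_le_sum fun j _ => Finset.sum_le_sum fun k _ => hterm j k
    _ = s ^ 2 * ∑ i, x i ^ 2 + ε * s ^ 2 * (∑ i, |x i|) ^ 2 := by
        rw [sq (∑ i, |x i|), Finset.sum_mul_sum]
        simp only [Finset.sum_add_distrib, Finset.mul_sum, Finset.sum_ite_eq, Finset.mem_univ,
          if_true]
    _ ≤ s ^ 2 * ∑ i, x i ^ 2 + ε * s ^ 2 * (s ^ 2 * ∑ i, x i ^ 2) := by gcongr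
    _ ≤ 2 * ε * s ^ 4 * ∑ i, x i ^ 2 := by
        have h1 : s ^ 2 ≤ ε * s ^ 4 := by
          have : 1 ≤ ε * s * s := by nlinarith
          nlinarith [sq_nonneg s]
        nlinarith [mul_le_mul_of_nonneg_right h1 hX]

lemma noise_quadratic_le (hp : p ∈ Set.Icc (0 : ℝ) 1) (h : TypicalNoise p ε ω) (hε : 0 ≤ ε)
    (hs : 1 ≤ ε * Real.sqrt n) (hs1 : 1 ≤ Real.sqrt n) {b : ℝ} (hb : 0 ≤ b) (hεb : 2 * ε ≤ b ^ 2)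
    (x : Fin n → ℝ) :
    ∑ i, x i * ∑ j, noise p ω i j * x j ≤ b * Real.sqrt n ^ 2 * ∑ i, x i ^ 2 := by
  have hX : 0 ≤ ∑ i, x i ^ 2 := Finset.sum_nonneg fun i _ => sq_nonneg _
  have h1 := Finset.sum_mul_sq_le_sq_mul_sq Finset.univ x fun i => ∑ j, noise p ω i j * x j
  have h2 := sum_mul_noise_sq_le hp h hε hs hs1 x
  have h3 : 2 * ε * Real.sqrt n ^ 4 * ∑ i, x i ^ 2 ≤ b ^ 2 * Real.sqrt n ^ 4 * ∑ i, x i ^ 2 := by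
    gcongr
  refine (le_abs_self _).trans (abs_le_of_sq_le_sq ?_ (by positivity))
  nlinarith [mul_le_mul_of_nonneg_left (h2.trans h3) hX]

lemma abs_total_le (h : TypicalNoise p ε ω) (hε : 0 ≤ ε) (hs : 1 ≤ ε * Real.sqrt n) :
    |∑ i, maskedRowSum p (fun _ => 1) ω i| ≤ ε * Real.sqrt n ^ 3 := by
  have h1 := h.total
  simp only [maskedRowSum, one_mul]
  refine abs_le_of_sq_le_sq (h1.trans ?_) (by positivity)
  have : 0 ≤ ε * Real.sqrt n ^ 5 := by positivity
  nlinarith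

lemma sum_noise_sq (ω : Sym2 (Fin n) → Bool) (i : Fin n) :
    ∑ j, noise p ω i j ^ 2 =
      (n - 1) * (p * (1 - p)) + (1 - 2 * p) * maskedRowSum p (fun _ => 1) ω i := by
  have h1 : ∑ j : Fin n, (if i = j then 0 else p * (1 - p)) = (n - 1) * (p * (1 - p)) := by
    have : ∀ j : Fin n, (if i = j then 0 else p * (1 - p)) =
        p * (1 - p) - if i = j then p * (1 - p) else 0 := fun j => by split_ifs <;> ring
    simp only [this, Finset.sum_sub_distrib, Finset.sum_ite_eq, Finset.mem_univ, if_true,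
      Finset.sum_const, Finset.card_univ, Fintype.card_fin, nsmul_eq_mul]
    ring
  simp only [noise_sq, Finset.sum_add_distrib, h1, maskedRowSum, one_mul, Finset.mul_sum]

lemma abs_cubic_le (hp : p ∈ Set.Icc (0 : ℝ) 1) (h : TypicalNoise p ε ω) (hε : 0 ≤ ε)
    (hs : 1 ≤ ε * Real.sqrt n) (hs1 : 1 ≤ Real.sqrt n) :
    |∑ i, maskedRowSum p (fun _ => 1) ω i * ∑ j, noise p ω i j * maskedRowSum p (fun _ => 1) ω j|
      ≤ 37 * (ε * Real.sqrt n ^ 5) := by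
  have hS := abs_total_le h hε hs
  have hH := h.normSq
  have hC := h.cubic
  rw [bernExp_decoupledCubic] at hC
  set s := Real.sqrt n with hsdef
  have hn : (n : ℝ) = s ^ 2 := natCast_eq_sqrt_sq n
  set r := maskedRowSum p (fun _ => 1) ω with hr
  have hrow : ∀ i, ∑ j, noise p ω i j ^ 2 = (s ^ 2 - 1) * (p * (1 - p)) + (1 - 2 * p) * r i := by
    intro i
    rw [sum_noise_sq, hn]
  have hT : |∑ i, ∑ j, noise p ω i j ^ 3| ≤ s ^ 4 := by
    have h1 : ∀ i j, |noise p ω i j ^ 3| ≤ 1 := fun i j => by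
      rw [abs_pow]; exact pow_le_one₀ (abs_nonneg _) (abs_noise_le hp ω i j)
    refine (Finset.abs_sum_le_sum_abs _ _).trans ((Finset.sum_le_sum fun i _ =>
      (Finset.abs_sum_le_sum_abs _ _).trans (Finset.sum_le_sum fun j _ => h1 i j)).trans ?_)
    simp only [Finset.sum_const, Finset.card_univ, Fintype.card_fin, nsmul_eq_mul, hn]
    exact le_of_eq (by ring)
  have hid : ∑ i, ∑ j, noise p ω i j * ((r i - noise p ω i j) * (r j - noise p ω i j)) =
      ∑ i, r i * ∑ j, noise p ω i j * r j
        - 2 * ((s ^ 2 - 1) * (p * (1 - p)) * ∑ i, r i + (1 - 2 * p) * ∑ i, r i ^ 2)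
        + ∑ i, ∑ j, noise p ω i j ^ 3 := by
    have h1 : ∑ i, ∑ j, noise p ω i j ^ 2 * r i =
        (s ^ 2 - 1) * (p * (1 - p)) * ∑ i, r i + (1 - 2 * p) * ∑ i, r i ^ 2 := by
      simp only [← Finset.sum_mul, hrow, Finset.mul_sum, ← Finset.sum_add_distrib]
      exact Finset.sum_congr rfl fun i _ => by ring
    have h2 : ∑ i, ∑ j, noise p ω i j ^ 2 * r j = ∑ i, ∑ j, noise p ω i j ^ 2 * r i := by
      rw [Finset.sum_comm]
      exact Finset.sum_congr rfl fun i _ => Finset.sum_congr rfl fun j _ => by rw [noise_comm]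
    rw [← h1, two_mul]
    nth_rewrite 2 [← h2]
    simp only [Finset.mul_sum, ← Finset.sum_add_distrib, ← Finset.sum_sub_distrib]
    exact Finset.sum_congr rfl fun i _ => Finset.sum_congr rfl fun j _ => by ring
  rw [hid] at hC
  have hp0 := hp.1
  have hp1 := hp.2
  have hH0 : 0 ≤ ∑ i, r i ^ 2 := Finset.sum_nonneg fun i _ => sq_nonneg _
  have hpp : 0 ≤ p * (1 - p) ∧ p * (1 - p) ≤ 1 := ⟨by nlinarith, by nlinarith⟩
  have hU : |(s ^ 2 - 1) * (p * (1 - p)) * ∑ i, r i| ≤ ε * s ^ 5 := by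
    have h1 : 0 ≤ (s ^ 2 - 1) * (p * (1 - p)) := mul_nonneg (by nlinarith) hpp.1
    have h2 : (s ^ 2 - 1) * (p * (1 - p)) ≤ s ^ 2 := by nlinarith
    rw [abs_mul, abs_of_nonneg h1]
    calc _ ≤ s ^ 2 * (ε * s ^ 3) := mul_le_mul h2 hS (abs_nonneg _) (by positivity)
      _ = ε * s ^ 5 := by ring
  have hV : |(1 - 2 * p) * ∑ i, r i ^ 2| ≤ 9 * s ^ 4 := by
    rw [abs_mul, abs_of_nonneg hH0]
    have : |1 - 2 * p| ≤ 1 := abs_le.2 ⟨by linarith, by linarith⟩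
    nlinarith
  have h4 : s ^ 4 ≤ ε * s ^ 5 := by
    have : 0 ≤ s ^ 4 := by positivity
    nlinarith
  rw [abs_le] at hC hT hU hV ⊢
  constructor <;> linarith [hC.1, hC.2, hT.1, hT.2, hU.1, hU.2, hV.1, hV.2]

lemma sum_noise_mul_rowSum_sq_le (hp : p ∈ Set.Icc (0 : ℝ) 1) (h : TypicalNoise p ε ω)
    (hs : 1 ≤ ε * Real.sqrt n) :
    ∑ i, (∑ j, noise p ω i j * maskedRowSum p (fun _ => 1) ω j) ^ 2 ≤ 4 * (ε * Real.sqrt n ^ 7) := by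
  have haway := h.away
  set s := Real.sqrt n with hsdef
  have hn : (n : ℝ) = s ^ 2 := natCast_eq_sqrt_sq n
  have hrow : ∀ i j, noise p ω i j * maskedRowSum p (fun _ => 1) ω j =
      noise p ω i j ^ 2 + maskedRowSum p (awayMask i) ω j * noise p ω i j := by
    intro i j
    by_cases hij : i = j
    · subst hij; simp [noise_self]
    have h1 : maskedRowSum p (fun _ => 1) ω j = noise p ω j i + maskedRowSum p (awayMask i) ω j := by
      have h2 : ∀ k, 1 * noise p ω j k =
          (if i = k then noise p ω j k else 0) + awayMask i s(j, k) * noise p ω j k := by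
        intro k
        by_cases hik : i = k <;> simp [awayMask, hij, hik]
      simp only [maskedRowSum, h2, Finset.sum_add_distrib, Finset.sum_ite_eq, Finset.mem_univ,
        if_true]
    rw [h1, noise_comm ω j i]
    ring
  have hi : ∀ i, (∑ j, noise p ω i j * maskedRowSum p (fun _ => 1) ω j) ^ 2 ≤ 4 * (ε * s ^ 5) := by
    intro i
    simp only [hrow, Finset.sum_add_distrib]
    have h1 : ∑ j, noise p ω i j ^ 2 ≤ s ^ 2 := by
      refine (Finset.sum_le_sum fun j _ => noise_sq_le hp ω i j).trans ?_
      simp [hn]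
    have h0 : 0 ≤ ∑ j, noise p ω i j ^ 2 := Finset.sum_nonneg fun i _ => sq_nonneg _
    have h3 := haway i
    have h4 : (s ^ 2) ^ 2 ≤ ε * s ^ 5 := by
      have : 0 ≤ s ^ 4 := by positivity
      nlinarith
    have h5 := pow_le_pow_left₀ h0 h1 2
    nlinarith [sq_nonneg (∑ j, noise p ω i j ^ 2 -
      ∑ j, maskedRowSum p (awayMask i) ω j * noise p ω i j)]
  refine (Finset.sum_le_sum fun i _ => hi i).trans (le_of_eq ?_)
  simp only [Finset.sum_const, Finset.card_univ, Fintype.card_fin, nsmul_eq_mul, hn]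
  ring

end TypicalNoise

/-! ### Moments of the degree sequence -/

/-- Numerical consequences of the noise estimates for the first two moments `d * s ^ 2 + S` and
`d ^ 2 * s ^ 2 + 2 * d * S + H` of the degree sequence. -/
lemma degree_moment_bounds {p ε s d S H : ℝ} (hp0 : 0 < p) (hp1 : p < 1)
    (hε : 0 < ε) (hεp : 10 ^ 6 * ε ≤ p ^ 4) (hs : 1 ≤ ε * s) (hd : d = p * (s ^ 2 - 1))
    (hS : |S| ≤ ε * s ^ 3) (hH0 : 0 ≤ H) :
    10 ^ 6 ≤ s ∧ p * s ^ 2 / 2 ≤ d ∧ d ≤ p * s ^ 2 ∧ p * s ^ 4 / 4 ≤ d * s ^ 2 + S ∧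
      p ^ 2 * s ^ 6 / 8 ≤ d ^ 2 * s ^ 2 + 2 * d * S + H := by
  have hp4 : p ^ 4 ≤ 1 := pow_le_one₀ hp0.le hp1.le
  have hpp : p ^ 4 ≤ p := by simpa using pow_le_pow_of_le_one hp0.le hp1.le (show 1 ≤ 4 by norm_num)
  have hs0 : 0 < s := by
    by_contra! hc
    nlinarith
  have hs6 : 10 ^ 6 ≤ s := by
    nlinarith
  have hd1 : p * s ^ 2 / 2 ≤ d := by
    rw [hd]
    have : 2 ≤ s ^ 2 := by nlinarith
    nlinarith
  have hd2 : d ≤ p * s ^ 2 := by rw [hd]; nlinarith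
  have hs2 : 0 < s ^ 2 := by positivity
  have hS' : |S| ≤ p / 8 * s ^ 4 := by
    have h1 : ε * s ^ 3 ≤ p / 8 * s ^ 3 := by
      have : ε ≤ p / 8 := by linarith
      gcongr
    have h2 : p / 8 * s ^ 3 ≤ p / 8 * s ^ 4 := by
      have : s ^ 3 ≤ s ^ 4 := pow_le_pow_right₀ (by linarith) (by norm_num)
      gcongr
    linarith
  have hSl := (abs_le.1 hS').1
  have hds : p * s ^ 4 / 2 ≤ d * s ^ 2 := by nlinarith [mul_le_mul_of_nonneg_right hd1 hs2.le]
  have hps : 0 < p * s ^ 4 := by positivity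
  refine ⟨hs6, hd1, hd2, by linarith, ?_⟩
  have h1 : p / 4 * s ^ 4 ≤ d * s ^ 2 + 2 * S := by linarith
  have hdpos : 0 ≤ p * s ^ 2 / 2 := by positivity
  have h2 := mul_le_mul hd1 h1 (by positivity) (hdpos.trans hd1)
  nlinarith

lemma abs_ratio_sub_rayleigh_le {p ε s d S H X : ℝ} (hp0 : 0 < p) (hp1 : p < 1)
    (hε : 0 < ε) (hεp : 10 ^ 6 * ε ≤ p ^ 4) (hs : 1 ≤ ε * s) (hd : d = p * (s ^ 2 - 1))
    (hS2 : S ^ 2 ≤ ε * s ^ 5) (hS : |S| ≤ ε * s ^ 3) (hH0 : 0 ≤ H) (hH : H ≤ 9 * s ^ 4)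
    (hX : |X| ≤ 47 * (ε * s ^ 5)) :
    |(d ^ 2 * s ^ 2 + 2 * d * S + H) / (d * s ^ 2 + S) -
      (d * (d ^ 2 * s ^ 2 + 2 * d * S + H) + d * (d * S + H) + X) /
        (d ^ 2 * s ^ 2 + 2 * d * S + H)| ≤ 5624 * ε / (p ^ 3 * s) := by
  obtain ⟨hs6, hd1, hd2, hm1, hm2⟩ := degree_moment_bounds hp0 hp1 hε hεp hs hd hS hH0
  have hs0 : 0 < s := by linarith
  set m1 := d * s ^ 2 + S with hm1def
  set m2 := d ^ 2 * s ^ 2 + 2 * d * S + H with hm2def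
  have hm1pos : 0 < m1 := lt_of_lt_of_le (by positivity) hm1
  have hm2pos : 0 < m2 := lt_of_lt_of_le (by positivity) hm2
  have hd0 : 0 ≤ d := le_trans (by positivity) hd1
  have hid : m2 / m1 - (d * m2 + d * (d * S + H) + X) / m2 =
      (d * S + H) ^ 2 / (m1 * m2) - X / m2 := by
    have : m2 = d * m1 + (d * S + H) := by rw [hm1def, hm2def]; ring
    field_simp
    rw [this]
    ring
  have hnum : (d * S + H) ^ 2 ≤ 164 * (ε * s ^ 9) := by
    have h1 : d ^ 2 * S ^ 2 ≤ ε * s ^ 9 := by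
      have h2 : d ≤ s ^ 2 := hd2.trans (by nlinarith [sq_nonneg s])
      calc d ^ 2 * S ^ 2 ≤ (s ^ 2) ^ 2 * (ε * s ^ 5) := by gcongr
        _ = ε * s ^ 9 := by ring
    have h3 : H ^ 2 ≤ 81 * (ε * s ^ 9) := by
      calc H ^ 2 ≤ (9 * s ^ 4) ^ 2 := by gcongr
        _ = 81 * (1 * s ^ 8) := by ring
        _ ≤ 81 * ((ε * s) * s ^ 8) := by gcongr
        _ = 81 * (ε * s ^ 9) := by ring
    nlinarith [sq_nonneg (d * S - H)]
  have hA : (d * S + H) ^ 2 / (m1 * m2) ≤ 5248 * ε / (p ^ 3 * s) := by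
    have h1 : p * s ^ 4 / 4 * (p ^ 2 * s ^ 6 / 8) ≤ m1 * m2 := by gcongr
    calc (d * S + H) ^ 2 / (m1 * m2)
        ≤ 164 * (ε * s ^ 9) / (p * s ^ 4 / 4 * (p ^ 2 * s ^ 6 / 8)) := by gcongr
      _ = 5248 * ε / (p ^ 3 * s) := by field_simp; norm_num
  have hB : |X / m2| ≤ 376 * ε / (p ^ 3 * s) := by
    rw [abs_div, abs_of_pos hm2pos]
    calc |X| / m2 ≤ 47 * (ε * s ^ 5) / (p ^ 2 * s ^ 6 / 8) := by gcongr
      _ = p * (376 * ε / (p ^ 3 * s)) := by field_simp; norm_num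
      _ ≤ 1 * (376 * ε / (p ^ 3 * s)) := by gcongr
      _ = _ := one_mul _
  have hsum : 5248 * ε / (p ^ 3 * s) + 376 * ε / (p ^ 3 * s) = 5624 * ε / (p ^ 3 * s) := by ring
  have hA0 : 0 ≤ (d * S + H) ^ 2 / (m1 * m2) := by positivity
  rw [hid]
  refine (abs_sub _ _).trans ?_
  rw [abs_of_nonneg hA0]
  linarith

lemma le_rayleigh {p ε s d S H X : ℝ} (hp0 : 0 < p) (hp1 : p < 1)
    (hε : 0 < ε) (hεp : 10 ^ 6 * ε ≤ p ^ 4) (hs : 1 ≤ ε * s) (hd : d = p * (s ^ 2 - 1))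
    (hS : |S| ≤ ε * s ^ 3) (hH0 : 0 ≤ H) (hX : |X| ≤ 47 * (ε * s ^ 5)) :
    p * s ^ 2 / 4 ≤ (d * (d ^ 2 * s ^ 2 + 2 * d * S + H) + d * (d * S + H) + X) /
        (d ^ 2 * s ^ 2 + 2 * d * S + H) := by
  obtain ⟨hs6, hd1, hd2, -, hm2⟩ := degree_moment_bounds hp0 hp1 hε hεp hs hd hS hH0
  have hs0 : 0 < s := by linarith
  generalize d ^ 2 * s ^ 2 + 2 * d * S + H = m2 at hm2 ⊢
  have hm2pos : 0 < m2 := lt_of_lt_of_le (by positivity) hm2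
  have hd0 : 0 ≤ d := le_trans (by positivity) hd1
  rw [le_div_iff₀ hm2pos]
  have hXl := (abs_le.1 hX).1
  have hSl := (abs_le.1 hS).1
  have hpow : p ^ 4 ≤ p ^ 3 := pow_le_pow_of_le_one hp0.le hp1.le (by norm_num)
  have hεp3 : ε ≤ p ^ 3 / 10 ^ 6 := by linarith
  have hs78 : s ^ 7 ≤ s ^ 8 := pow_le_pow_right₀ (by linarith) (by norm_num)
  have hs58 : s ^ 5 ≤ s ^ 8 := pow_le_pow_right₀ (by linarith) (by norm_num)
  have h2 : d ^ 2 * (ε * s ^ 3) ≤ p ^ 3 / 10 ^ 6 * s ^ 8 := by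
    calc d ^ 2 * (ε * s ^ 3) ≤ (p * s ^ 2) ^ 2 * (ε * s ^ 3) := by gcongr
      _ = p ^ 2 * (ε * s ^ 7) := by ring
      _ ≤ 1 * (p ^ 3 / 10 ^ 6 * s ^ 8) := by
        gcongr
        exact pow_le_one₀ hp0.le hp1.le
      _ = _ := one_mul _
  have h3 : d ^ 2 * -(ε * s ^ 3) ≤ d ^ 2 * S := by gcongr
  have h4 : p * s ^ 2 / 4 * (p ^ 2 * s ^ 6 / 8) ≤ p * s ^ 2 / 4 * m2 := by gcongr
  have h5 : ε * s ^ 5 ≤ p ^ 3 / 10 ^ 6 * s ^ 8 := by gcongr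
  have h6 : 0 ≤ d * H := by positivity
  have h7 : p * s ^ 2 / 2 * m2 ≤ d * m2 := by gcongr
  have h8 : 0 < p ^ 3 * s ^ 8 := by positivity
  have h9 : p * s ^ 2 / 4 * (p ^ 2 * s ^ 6 / 8) = p ^ 3 * s ^ 8 / 32 := by ring
  linarith

/-! ### The largest eigenvalue under typical noise -/

section LargestEigenvalue

open Matrix

variable {n : ℕ} {p ε : ℝ} {ω : Sym2 (Fin n) → Bool}

lemma adjMat_graphOf_mulVec (ω : Sym2 (Fin n) → Bool) (x : Fin n → ℝ) (i : Fin n) :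
    (adjMat (graphOf ω) *ᵥ x) i = ∑ j, noise p ω i j * x j + p * (∑ j, x j - x i) := by
  have h : ∀ j, adjMat (graphOf ω) i j * x j =
      noise p ω i j * x j + (p * x j - if i = j then p * x j else 0) := fun j => by
    rw [adjMat_graphOf (p := p)]
    split_ifs <;> ring
  simp only [mulVec, dotProduct, h, Finset.sum_add_distrib, Finset.sum_sub_distrib,
    Finset.sum_ite_eq, Finset.mem_univ, if_true, ← Finset.mul_sum]
  ring

lemma degR_graphOf (ω : Sym2 (Fin n) → Bool) (i : Fin n) :
    degR (graphOf ω) i = maskedRowSum p (fun _ => 1) ω i + p * (Real.sqrt n ^ 2 - 1) := by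
  have h := adjMat_graphOf_mulVec (p := p) ω (fun _ => 1) i
  simp only [mulVec, dotProduct, mul_one, Finset.sum_const, Finset.card_univ, Fintype.card_fin,
    nsmul_eq_mul] at h
  simp only [degR, h, maskedRowSum, one_mul, ← natCast_eq_sqrt_sq]

lemma adjMat_isHermitian (g : SimpleGraph (Fin n)) : (adjMat g).IsHermitian := by
  rw [IsHermitian, conjTranspose_eq_transpose_of_trivial]
  exact SimpleGraph.isSymm_adjMatrix g

lemma TypicalNoise.dotProduct_mulVec_le (hp0 : 0 < p) (hp1 : p < 1) (h : TypicalNoise p ε ω)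
    (hε : 0 < ε) (hεp : 10 ^ 6 * ε ≤ p ^ 4) (hs : 1 ≤ ε * Real.sqrt n) {w : Fin n → ℝ}
    (hw : w ⬝ᵥ degR (graphOf ω) = 0) :
    w ⬝ᵥ adjMat (graphOf ω) *ᵥ w ≤ p * Real.sqrt n ^ 2 / 8 * (w ⬝ᵥ w) := by
  have hp : p ∈ Set.Icc (0 : ℝ) 1 := ⟨hp0.le, hp1.le⟩
  have hS := h.abs_total_le hε.le hs
  have hH := h.normSq
  have hH0 : 0 ≤ ∑ i, maskedRowSum p (fun _ => 1) ω i ^ 2 :=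
    Finset.sum_nonneg fun i _ => sq_nonneg _
  obtain ⟨hs6, hd1, -, -, -⟩ := degree_moment_bounds hp0 hp1 hε hεp hs rfl hS hH0
  have hp42 : p ^ 4 ≤ p ^ 2 := pow_le_pow_of_le_one hp0.le hp1.le (by norm_num)
  have hB := h.noise_quadratic_le hp hε.le hs (by linarith) (b := p / 16) (by linarith)
    (by nlinarith) w
  have hww : w ⬝ᵥ w = ∑ i, w i ^ 2 := Finset.sum_congr rfl fun i _ => (sq _).symm
  have hquad : w ⬝ᵥ adjMat (graphOf ω) *ᵥ w =
      ∑ i, w i * ∑ j, noise p ω i j * w j + p * (∑ i, w i) ^ 2 - p * ∑ i, w i ^ 2 := by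
    simp only [dotProduct, adjMat_graphOf_mulVec (p := p), mul_add, mul_sub,
      Finset.sum_add_distrib, Finset.sum_sub_distrib, sq, Finset.mul_sum, Finset.sum_mul]
    have h1 : ∀ i : Fin n, w i * (p * w i) = p * (w i * w i) := fun i => by ring
    have h2 : ∀ i j : Fin n, w i * (p * w j) = p * (w j * w i) := fun i j => by ring
    simp only [h1, h2]
    rw [Finset.sum_comm (f := fun i j => p * (w j * w i))]
    ring
  have hW0 : 0 ≤ ∑ i, w i ^ 2 := Finset.sum_nonneg fun i _ => sq_nonneg _
  have hCS := Finset.sum_mul_sq_le_sq_mul_sq Finset.univ w (maskedRowSum p (fun _ => 1) ω)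
  have horth : ∑ i, w i * maskedRowSum p (fun _ => 1) ω i =
      -(p * (Real.sqrt n ^ 2 - 1) * ∑ i, w i) := by
    simp only [dotProduct, degR_graphOf (p := p), mul_add, Finset.sum_add_distrib,
      ← Finset.sum_mul] at hw
    linarith
  rw [horth] at hCS
  rw [hquad, hww]
  set s := Real.sqrt n
  generalize ∑ i, w i = σ at *
  generalize ∑ i, w i ^ 2 = W at *
  generalize ∑ i, maskedRowSum p (fun _ => 1) ω i ^ 2 = H at *
  have h1 : (p * s ^ 2 / 2) ^ 2 * σ ^ 2 ≤ W * (9 * s ^ 4) := by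
    calc (p * s ^ 2 / 2) ^ 2 * σ ^ 2 ≤ (p * (s ^ 2 - 1)) ^ 2 * σ ^ 2 := by gcongr
      _ = (-(p * (s ^ 2 - 1) * σ)) ^ 2 := by ring
      _ ≤ W * H := hCS
      _ ≤ W * (9 * s ^ 4) := by gcongr
  have h2 : p ^ 2 * σ ^ 2 ≤ 36 * W := by
    have : 0 < s ^ 4 := by positivity
    nlinarith
  have h3 : 576 ≤ p ^ 2 * s ^ 2 := by
    have h4 : 10 ^ 6 ≤ p ^ 4 * s := by nlinarith
    have h5 : p ^ 4 * s ≤ p ^ 2 * s := by gcongr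
    have h6 : p ^ 2 * s ≤ p ^ 2 * s ^ 2 := by gcongr; nlinarith
    linarith
  have h4 : p * (p * σ ^ 2) ≤ p * (p * s ^ 2 / 16 * W) := by
    have := mul_le_mul_of_nonneg_right h3 hW0
    nlinarith
  have h5 := le_of_mul_le_mul_left h4 hp0
  have h6 : 0 ≤ p * W := by positivity
  linarith

lemma TypicalNoise.abs_ratio_sub_lam1_le [NeZero n] (hp0 : 0 < p) (hp1 : p < 1)
    (h : TypicalNoise p ε ω) (hε : 0 < ε) (hεp : 10 ^ 6 * ε ≤ p ^ 4) (hs : 1 ≤ ε * Real.sqrt n) :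
    |(∑ i, degR (graphOf ω) i ^ 2) / (∑ i, degR (graphOf ω) i) - lam1 (adjMat (graphOf ω))| ≤
      8312 * ε / (p ^ 3 * Real.sqrt n) := by
  have hp : p ∈ Set.Icc (0 : ℝ) 1 := ⟨hp0.le, hp1.le⟩
  have hS := h.abs_total_le hε.le hs
  have hS2 : (∑ i, maskedRowSum p (fun _ => 1) ω i) ^ 2 ≤ ε * Real.sqrt n ^ 5 := by
    simpa only [maskedRowSum, one_mul] using h.total
  have hH := h.normSq
  have hH0 : 0 ≤ ∑ i, maskedRowSum p (fun _ => 1) ω i ^ 2 :=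
    Finset.sum_nonneg fun i _ => sq_nonneg _
  obtain ⟨hs6, hd1, hd2, hm1, hm2⟩ := degree_moment_bounds hp0 hp1 hε hεp hs rfl hS hH0
  have hF := h.abs_cubic_le hp hε.le hs (by linarith)
  have hQ := h.sum_noise_mul_rowSum_sq_le hp hs
  have horth := fun w hw => h.dotProduct_mulVec_le hp0 hp1 hε hεp hs (w := w) hw
  set s := Real.sqrt n
  have hn : (n : ℝ) = s ^ 2 := natCast_eq_sqrt_sq n
  have hs0 : 0 < s := by linarith
  set d := p * (s ^ 2 - 1) with hd
  set r := maskedRowSum p (fun _ => 1) ω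
  set K := degR (graphOf ω)
  set M := adjMat (graphOf ω)
  have hK : ∀ i, K i = r i + d := degR_graphOf ω
  set S := ∑ i, r i with hSdef
  set H := ∑ i, r i ^ 2 with hHdef
  set F := ∑ i, r i * ∑ j, noise p ω i j * r j with hFdef
  set Q := ∑ i, (∑ j, noise p ω i j * r j) ^ 2 with hQdef
  have hM1 : ∑ i, K i = d * s ^ 2 + S := by
    simp only [hK, Finset.sum_add_distrib, Finset.sum_const, Finset.card_univ, Fintype.card_fin,
      nsmul_eq_mul, hn]
    ring
  have hM2 : ∑ i, K i ^ 2 = d ^ 2 * s ^ 2 + 2 * d * S + H := by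
    have : ∀ i, K i ^ 2 = r i ^ 2 + 2 * d * r i + d ^ 2 := fun i => by rw [hK]; ring
    simp only [this, Finset.sum_add_distrib, Finset.sum_const, Finset.card_univ, Fintype.card_fin,
      nsmul_eq_mul, hn, ← Finset.mul_sum]
    ring
  have hKK : K ⬝ᵥ K = d ^ 2 * s ^ 2 + 2 * d * S + H := by
    rw [← hM2]
    exact Finset.sum_congr rfl fun i _ => (sq _).symm
  let e : Fin n → ℝ := fun i => ∑ j, noise p ω i j * r j + (p * S - p * r i)
  have hMK : M *ᵥ K = d • K + e := by
    funext i
    have h1 : ∑ j, noise p ω i j * K j = ∑ j, noise p ω i j * r j + d * r i := by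
      have h2 : ∑ j, noise p ω i j = r i := by simp only [r, maskedRowSum, one_mul]
      simp only [hK, mul_add, Finset.sum_add_distrib, ← Finset.sum_mul, h2]
      ring
    rw [adjMat_graphOf_mulVec (p := p), h1, hM1, Pi.add_apply, Pi.smul_apply, smul_eq_mul, hK]
    simp only [e]
    rw [hd]
    ring
  have hBsum : ∑ i, ∑ j, noise p ω i j * r j = H := by
    rw [Finset.sum_comm]
    refine Finset.sum_congr rfl fun j _ => ?_
    rw [← Finset.sum_mul, sq]
    congr 1
    simp only [r, maskedRowSum, one_mul]
    exact Finset.sum_congr rfl fun i _ => noise_comm ω i j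
  have hKe : K ⬝ᵥ e = d * (d * S + H) + (F + p * S ^ 2 - p * H) := by
    have h1 : ∀ i, K i * e i = r i * (∑ j, noise p ω i j * r j) + p * S * r i - p * r i ^ 2 +
        d * (∑ j, noise p ω i j * r j) + d * (p * S) - d * p * r i := fun i => by
      simp only [hK, e]
      ring
    simp only [dotProduct, h1, Finset.sum_add_distrib, Finset.sum_sub_distrib, ← Finset.mul_sum,
      hBsum, Finset.sum_const, Finset.card_univ, Fintype.card_fin, nsmul_eq_mul, hn]
    rw [← hSdef, ← hHdef, ← hFdef, hd]
    ring
  have hee : e ⬝ᵥ e ≤ 42 * (ε * s ^ 7) := by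
    have h1 : e ⬝ᵥ e ≤ 3 * (Q + s ^ 2 * (p * S) ^ 2 + p ^ 2 * H) := by
      have h2 : ∀ i, e i * e i ≤
          3 * ((∑ j, noise p ω i j * r j) ^ 2 + (p * S) ^ 2 + p ^ 2 * r i ^ 2) := fun i => by
        simp only [e]
        nlinarith [sq_nonneg ((∑ j, noise p ω i j * r j) - p * S),
          sq_nonneg ((∑ j, noise p ω i j * r j) + p * r i), sq_nonneg (p * S + p * r i)]
      refine (Finset.sum_le_sum fun i _ => h2 i).trans (le_of_eq ?_)
      simp only [← Finset.mul_sum, Finset.sum_add_distrib, Finset.sum_const, Finset.card_univ,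
        Fintype.card_fin, nsmul_eq_mul, hn]
      rfl
    have h3 : s ^ 2 * (p * S) ^ 2 ≤ ε * s ^ 7 := by
      calc s ^ 2 * (p * S) ^ 2 = p ^ 2 * (s ^ 2 * S ^ 2) := by ring
        _ ≤ 1 * (s ^ 2 * (ε * s ^ 5)) := by
          gcongr
          exact pow_le_one₀ hp0.le hp1.le
        _ = ε * s ^ 7 := by ring
    have h4 : p ^ 2 * H ≤ 9 * (ε * s ^ 7) := by
      calc p ^ 2 * H ≤ 1 * (9 * s ^ 4) := by
            gcongr
            exact pow_le_one₀ hp0.le hp1.le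
        _ = 9 * (1 * (1 * s ^ 4)) := by ring
        _ ≤ 9 * ((ε * s) * (s ^ 2 * s ^ 4)) := by
          gcongr
          exact one_le_pow₀ (by linarith)
        _ = 9 * (ε * s ^ 7) := by ring
    linarith
  have hX : |F + p * S ^ 2 - p * H| ≤ 47 * (ε * s ^ 5) := by
    have h1 : 0 ≤ p * S ^ 2 := by positivity
    have h2 : p * S ^ 2 ≤ 1 * (ε * s ^ 5) := by gcongr
    have h3 : 0 ≤ p * H := by positivity
    have h4 : p * H ≤ 1 * (9 * s ^ 4) := by gcongr
    have h5 : 1 * s ^ 4 ≤ ε * s * s ^ 4 := by gcongr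
    have h6 : ε * s * s ^ 4 = ε * s ^ 5 := by ring
    rw [abs_le] at hF ⊢
    constructor <;> linarith [hF.1, hF.2]
  have hratio := abs_ratio_sub_rayleigh_le hp0 hp1 hε hεp hs hd hS2 hS hH0 hH hX
  have hray := le_rayleigh hp0 hp1 hε hεp hs hd hS hH0 hX
  rw [← hM1, ← hM2] at hratio
  rw [← hKK] at hm2 hray
  rw [hM2, ← hKK] at hratio ⊢
  have hKpos : 0 < K ⬝ᵥ K := lt_of_lt_of_le (by positivity) hm2
  set ρ := (d * (K ⬝ᵥ K) + d * (d * S + H) + (F + p * S ^ 2 - p * H)) / (K ⬝ᵥ K) with hρ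
  have hKMK : K ⬝ᵥ M *ᵥ K = ρ * (K ⬝ᵥ K) := by
    rw [hρ, div_mul_cancel₀ _ hKpos.ne', hMK, dotProduct_add, dotProduct_smul, hKe, smul_eq_mul]
    ring
  have hM : M.IsHermitian := adjMat_isHermitian _
  have hlow : ρ ≤ lam1 M := by
    have := dotProduct_mulVec_le_lam1 hM K
    rw [hKMK] at this
    exact le_of_mul_le_mul_right this hKpos
  have hps : 0 < p * s ^ 2 := by positivity
  have hup : lam1 M ≤ ρ + 2688 * ε / (p ^ 3 * s) := by
    refine lam1_le_of_residual hM hMK hKMK hKpos (μ := p * s ^ 2 / 8) (by linarith) horth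
      (by positivity) (hee.trans ?_)
    have h1 : p * s ^ 2 / 8 ≤ ρ - p * s ^ 2 / 8 := by linarith
    calc 42 * (ε * s ^ 7) = 2688 * ε / (p ^ 3 * s) * (p ^ 2 * s ^ 6 / 8) * (p * s ^ 2 / 8) := by
          field_simp
          norm_num
      _ ≤ _ := by gcongr
  have hfin : 5624 * ε / (p ^ 3 * s) + 2688 * ε / (p ^ 3 * s) = 8312 * ε / (p ^ 3 * s) := by ring
  have h0 : 0 ≤ 2688 * ε / (p ^ 3 * s) := by positivity
  rw [abs_le] at hratio ⊢
  constructor <;> linarith [hratio.1, hratio.2]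

end LargestEigenvalue

/-- Concentration of the ratio `Σ K_i² / Σ K_i` around the largest adjacency
eigenvalue `λ₁` under `G(n,p)`: for every `η > 0` there are constants
`ζ, Λ ∈ (0,∞)` such that, for all `n ≥ 2`,
`P( |Σ K_i² / Σ K_i − λ₁| ≥ η/√n ) ≤ Λ exp(−ζ √n)`
(division by zero is interpreted as zero, Lean's convention). -/
theorem ratio_approximates_largest_eigenvalue
    (p : ℝ) (hp : p ∈ Set.Ioo (0 : ℝ) 1) :
    ∀ η : ℝ, 0 < η →
      ∃ ζ Λ : ℝ, 0 < ζ ∧ 0 < Λ ∧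
        ∀ n : ℕ, 2 ≤ n →
          erProb n p
              {g : SimpleGraph (Fin n) |
                η / Real.sqrt n ≤
                  |(∑ i, degR g i ^ 2) / (∑ i, degR g i) - lam1 (adjMat g)|}
            ≤ Λ * Real.exp (-ζ * Real.sqrt n) := by
  intro η hη
  have hp0 : 0 < p := hp.1
  have hp1 : p < 1 := hp.2
  have hpI : p ∈ Set.Icc (0 : ℝ) 1 := ⟨hp0.le, hp1.le⟩
  obtain ⟨ε, hε, hεp, hεη⟩ : ∃ ε : ℝ, 0 < ε ∧ 10 ^ 6 * ε ≤ p ^ 4 ∧ 10 ^ 4 * ε ≤ η * p ^ 3 := by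
    refine ⟨min (p ^ 4 / 10 ^ 6) (η * p ^ 3 / 10 ^ 4), by positivity, ?_, ?_⟩
    · linarith [min_le_left (p ^ 4 / 10 ^ 6) (η * p ^ 3 / 10 ^ 4)]
    · linarith [min_le_right (p ^ 4 / 10 ^ 6) (η * p ^ 3 / 10 ^ 4)]
  obtain ⟨q, ⟨ζ, Λ, hζ, hΛ, hq⟩, hbound⟩ := exists_bound_not_typicalNoise hpI hε
  refine ⟨ζ, Λ + Real.exp (ζ / ε), hζ, by positivity, fun n hn => ?_⟩
  have : NeZero n := ⟨by omega⟩
  have hs0 : 0 < Real.sqrt n := Real.sqrt_pos.2 (by exact_mod_cast (by omega : 0 < n))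
  rw [erProb_eq_bernProb, add_mul]
  by_cases hs : 1 ≤ ε * Real.sqrt n
  · have h1 := bernProb_mono hpI (P := fun ω => graphOf ω ∈ {g : SimpleGraph (Fin n) |
        η / Real.sqrt n ≤ |(∑ i, degR g i ^ 2) / (∑ i, degR g i) - lam1 (adjMat g)|})
      (Q := fun ω => ¬ TypicalNoise p ε ω) fun ω hω h => by
        have h2 : η / Real.sqrt n ≤ 8312 * ε / (p ^ 3 * Real.sqrt n) :=
          le_trans hω (h.abs_ratio_sub_lam1_le hp0 hp1 hε hεp hs)
        rw [div_le_div_iff₀ hs0 (by positivity), ← mul_assoc] at h2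
        have h3 := le_of_mul_le_mul_right h2 hs0
        linarith
    have h4 : 0 ≤ Real.exp (ζ / ε) * Real.exp (-ζ * Real.sqrt n) := by positivity
    linarith [hbound n (by omega), hq n]
  · have h1 : Real.sqrt n ≤ 1 / ε := by
      rw [le_div_iff₀ hε]
      linarith
    have h2 : 1 ≤ Real.exp (ζ / ε) * Real.exp (-ζ * Real.sqrt n) := by
      rw [← Real.exp_add]
      refine Real.one_le_exp ?_
      have h3 := mul_le_mul_of_nonneg_left h1 hζ.le
      rw [mul_one_div] at h3
      linarith
    have h4 : 0 ≤ Λ * Real.exp (-ζ * Real.sqrt n) := by positivity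
    linarith [bernProb_le_one hpI (fun ω => graphOf ω ∈ {g : SimpleGraph (Fin n) |
      η / Real.sqrt n ≤ |(∑ i, degR g i ^ 2) / (∑ i, degR g i) - lam1 (adjMat g)|})]
end
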